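/- arXiv:2509.09925 — 6 statements merged into one kernel-verified Lean document; each statement's English description precedes it below -/
import Mathlib

section
/- Let G be a graph with n vertices, m edges, and c connected components, and let ω(G) = m − n + c be the dimension of its cycle space. Then α_4(G) ≥ (3/4)(n − ω(G)). -/
/-- `S` is a generalized `k`-independent set of `G`: the induced subgraph `G[S]` contains no
tree on `k` vertices as a subgraph, equivalently every connected component of `G[S]` has
fewer than `k` vertices, equivalently every connected induced subgraph inside `S` has
fewer than `k` vertices. -/
def SimpleGraph.IsGenIndepSet {V : Type*} (G : SimpleGraph V) (k : ℕ) (S : Finset V) : Prop :=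
  ∀ T : Finset V, T ⊆ S → (G.induce (T : Set V)).Connected → T.card < k

/-- The generalized `k`-independence number `α_k(G)`, the maximum cardinality of a
generalized `k`-independent set. -/
noncomputable def SimpleGraph.genIndepNum {V : Type*} (G : SimpleGraph V) (k : ℕ) : ℕ :=
  sSup {n | ∃ S : Finset V, G.IsGenIndepSet k S ∧ S.card = n}

/-- The dimension of the cycle space of `G`: `ω(G) = m - n + c`, where `m` is the number of
edges, `n` the number of vertices and `c` the number of connected components. -/
noncomputable def SimpleGraph.cycleDim {V : Type*} (G : SimpleGraph V) : ℤ :=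
  (Nat.card G.edgeSet : ℤ) - (Nat.card V : ℤ) + (Nat.card G.ConnectedComponent : ℤ)

namespace GenIndepAux

open SimpleGraph

lemma card_le {V : Type*} [Finite V] (G : SimpleGraph V) :
    Nat.card V ≤ Nat.card G.edgeSet + Nat.card G.ConnectedComponent := by
  classical
  have : Finite G.ConnectedComponent := Quot.finite _
  rw [← Nat.card_sum]
  let root : V → V := fun v => (G.connectedComponentMk v).out
  have hroot : ∀ v, G.Reachable (root v) v := fun v =>
    ConnectedComponent.exact (Quot.out_eq (G.connectedComponentMk v))
  have hadj : ∀ v w, G.Adj v w → root v = root w := by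
    intro v w h
    have : G.connectedComponentMk v = G.connectedComponentMk w :=
      ConnectedComponent.sound h.reachable
    simp only [root, this]
  have key : ∀ v, v ≠ root v → ∃ w, G.Adj v w ∧ G.dist (root v) w < G.dist (root v) v := by
    intro v hv
    obtain ⟨p, hp⟩ := (hroot v).symm.exists_walk_length_eq_dist
    revert p
    generalize root v = r at hv ⊢
    intro p hp
    cases p with
    | nil => exact absurd rfl hv
    | cons h q =>
      rename_i w
      refine ⟨w, h, ?_⟩
      rw [G.dist_comm, G.dist_comm (u := r), ← hp]
      have := dist_le q
      simp only [Walk.length_cons]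
      omega
  choose! f hf1 hf2 using key
  let g : V → G.edgeSet ⊕ G.ConnectedComponent := fun v =>
    if h : v = root v then Sum.inr (G.connectedComponentMk v)
    else Sum.inl ⟨s(v, f v), hf1 v h⟩
  refine Nat.card_le_card_of_injective g ?_
  intro a b hab
  by_cases ha : a = root a <;> by_cases hb : b = root b
  · simp only [g, dif_pos ha, dif_pos hb, Sum.inr.injEq] at hab
    rw [ha, hb]
    simp only [root, hab]
  · simp [g, dif_pos ha, dif_neg hb] at hab
  · simp [g, dif_neg ha, dif_pos hb] at hab
  · simp only [g, dif_neg ha, dif_neg hb, Sum.inl.injEq] at hab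
    have hab := Sym2.eq_iff.1 (congrArg Subtype.val hab)
    rcases hab with h | ⟨h1, h2⟩
    · exact h.1
    · have e := hadj a _ (hf1 a ha)
      have A := hf2 a ha
      have B := hf2 b hb
      rw [h2] at e A
      rw [← h1, ← e] at B
      omega

/-- a vertex outside a connected set in a forest has at most one neighbour in it -/
lemma unique_nbr {V : Type*} {F : SimpleGraph V} (hF : F.IsAcyclic) {T : Set V}
    (hT : (F.induce T).Connected) {v a b : V} (hv : v ∉ T) (ha : a ∈ T) (hb : b ∈ T)
    (hva : F.Adj v a) (hvb : F.Adj v b) : a = b := by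
  classical
  by_contra hne
  obtain ⟨p, hp⟩ := (hT.preconnected ⟨a, ha⟩ ⟨b, hb⟩).exists_isPath
  let p' : F.Walk a b := p.map (Embedding.induce T).toHom
  have hp' : p'.IsPath := hp.map (Embedding.induce (G := F) T).injective
  let q : F.Walk a b := Walk.cons hva.symm (Walk.cons hvb Walk.nil)
  have hq : q.IsPath := by
    simp [q, Walk.cons_isPath_iff, hva.ne', hvb.ne, hne]
  have h := congrArg Subtype.val (hF.path_unique ⟨p', hp'⟩ ⟨q, hq⟩)
  have hvq : v ∈ p'.support := by
    have h' : p' = q := h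
    rw [h']; simp [q]
  have hvq2 : v ∈ p.support.map (Embedding.induce (G := F) T).toHom :=
    (Walk.support_map (Embedding.induce (G := F) T).toHom p) ▸ hvq
  obtain ⟨x, -, hx⟩ := List.mem_map.1 hvq2
  exact hv (hx ▸ x.2)

/-- A connected set inside `A ∪ B` with no edges between is inside one of them. -/
lemma conn_split {V : Type*} {F : SimpleGraph V} {T A B : Set V}
    (hT : (F.induce T).Connected) (hTAB : T ⊆ A ∪ B)
    (hAB : ∀ a ∈ A, ∀ b ∈ B, ¬ F.Adj a b) (hd : Disjoint A B) : T ⊆ A ∨ T ⊆ B := by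
  have step : ∀ x y : T, (F.induce T).Walk x y → (x : V) ∈ A → (y : V) ∈ A := by
    intro x y p
    induction p with
    | nil => exact id
    | cons h q ih =>
      intro hx
      apply ih
      rcases hTAB (Subtype.mem _) with h' | h'
      · exact h'
      · exact absurd h (hAB _ hx _ h')
  by_cases h : ∃ x : T, (x : V) ∈ A
  · obtain ⟨x, hx⟩ := h
    left
    intro y hy
    obtain ⟨p⟩ := hT.preconnected x ⟨y, hy⟩
    exact step _ _ p hx
  · right
    intro y hy
    rcases hTAB hy with h' | h'
    · exact absurd ⟨⟨y, hy⟩, h'⟩ h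
    · exact h'

lemma exists_cut {V : Type*} [DecidableEq V] {F : SimpleGraph V} (hF : F.IsAcyclic) (W : Finset V)
    (n : ℕ) : ∀ (B : Finset V) (v : V), B.card = n → v ∈ B → B ⊆ W → 4 ≤ B.card →
      (∀ x ∈ B, x ≠ v → ∀ y ∈ W, y ∉ B → ¬ F.Adj x y) →
      ∃ (C : Finset V) (u : V), u ∈ C ∧ C ⊆ W ∧ 4 ≤ C.card ∧
      (∀ x ∈ C, x ≠ u → ∀ y ∈ W, y ∉ C → ¬ F.Adj x y) ∧ F.IsGenIndepSet 4 (C.erase u) := by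
  induction n using Nat.strong_induction_on with
  | _ n ih =>
  intro B v hn hv hBW hB hcut
  by_cases hind : F.IsGenIndepSet 4 (B.erase v)
  · exact ⟨B, v, hv, hBW, hB, hcut, hind⟩
  have hex : ∃ T ∈ (B.erase v).powerset, (F.induce (T : Set V)).Connected ∧ 4 ≤ T.card := by
    unfold SimpleGraph.IsGenIndepSet at hind
    push Not at hind
    obtain ⟨T, h1, h2, h3⟩ := hind
    exact ⟨T, by simpa using h1, h2, h3⟩
  classical
  obtain ⟨T0, hT0, hT0'⟩ := hex
  obtain ⟨T, hTm, hmax⟩ := Finset.exists_max_image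
    ((B.erase v).powerset.filter fun T : Finset V => (F.induce (T : Set V)).Connected ∧ 4 ≤ T.card)
    Finset.card ⟨T0, by rw [Finset.mem_filter]; exact ⟨hT0, hT0'⟩⟩
  rw [Finset.mem_filter, Finset.mem_powerset] at hTm
  obtain ⟨hTs, hTc, hT4⟩ := hTm
  have hvT : v ∉ T := fun h => by simpa using hTs h
  have hTB : T ⊆ B := hTs.trans (Finset.erase_subset _ _)
  have hlt : T.card < n := by
    rw [← hn]
    exact Finset.card_lt_card ⟨hTB, fun h => hvT (h hv)⟩
  have hmax' : ∀ x ∈ T, ∀ y ∈ B, y ≠ v → y ∉ T → ¬ F.Adj x y := by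
    intro x hx y hy hyv hyT hxy
    have hc : (F.induce ((insert y T : Finset V) : Set V)).Connected := by
      have h1 := induce_union_connected hTc.preconnected
        (induce_pair_connected_of_adj hxy).preconnected ⟨x, by simpa using hx, by simp⟩
      have h2 : ((insert y T : Finset V) : Set V) = (T : Set V) ∪ {x, y} := by
        ext z
        simp
        rintro rfl
        exact Or.inr hx
      rw [h2]
      exact h1
    have := hmax (insert y T) (by
      rw [Finset.mem_filter, Finset.mem_powerset]
      refine ⟨Finset.insert_subset (Finset.mem_erase.2 ⟨hyv, hy⟩) hTs, hc, ?_⟩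
      rw [Finset.card_insert_of_notMem hyT]; omega)
    rw [Finset.card_insert_of_notMem hyT] at this
    omega
  obtain ⟨u, huT, hu⟩ : ∃ u ∈ T, ∀ x ∈ T, x ≠ u → ¬ F.Adj x v := by
    by_cases h : ∃ u ∈ T, F.Adj u v
    · obtain ⟨u, hu, huv⟩ := h
      refine ⟨u, hu, fun x hx hxu hxv => hxu ?_⟩
      exact unique_nbr hF hTc (by simpa using hvT) (by simpa using hx) (by simpa using hu)
        hxv.symm huv.symm
    · push Not at h
      obtain ⟨u, hu⟩ : T.Nonempty := Finset.card_pos.1 (by omega)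
      exact ⟨u, hu, fun x hx _ => h x hx⟩
  refine ih T.card hlt T u rfl huT (hTB.trans hBW) hT4 ?_
  intro x hx hxu y hyW hyT
  by_cases hyv : y = v
  · rw [hyv]; exact hu x hx hxu
  by_cases hyB : y ∈ B
  · exact hmax' x hx y hyB hyv hyT
  · exact hcut x (hTB hx) (fun h => hvT (h ▸ hx)) y hyW hyB

lemma forest {V : Type*} [DecidableEq V] {F : SimpleGraph V} (hF : F.IsAcyclic) (n : ℕ) :
    ∀ W : Finset V, W.card = n →
      ∃ S ⊆ W, F.IsGenIndepSet 4 S ∧ 3 * W.card ≤ 4 * S.card := by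
  induction n using Nat.strong_induction_on with
  | _ n ih =>
  intro W hn
  by_cases hW : W.card < 4
  · exact ⟨W, subset_rfl, fun T hT _ => (Finset.card_le_card hT).trans_lt hW, by omega⟩
  obtain ⟨v, hv⟩ : W.Nonempty := Finset.card_pos.1 (by omega)
  obtain ⟨C, u, huC, hCW, hC4, hcut, hind⟩ := exists_cut hF W _ W v rfl hv subset_rfl (by omega)
    (fun x _ _ y hy hy' => absurd hy hy')
  have hc : (W \ C).card = W.card - C.card := Finset.card_sdiff_of_subset hCW
  have hle := Finset.card_le_card hCW
  obtain ⟨S, hS, hSi, hSc⟩ := ih (W \ C).card (by omega) (W \ C) rfl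
  have hd : Disjoint (C.erase u) S := by
    rw [Finset.disjoint_left]
    intro a ha haS
    exact (Finset.mem_sdiff.1 (hS haS)).2 (Finset.mem_of_mem_erase ha)
  refine ⟨C.erase u ∪ S, ?_, ?_, ?_⟩
  · exact Finset.union_subset ((Finset.erase_subset _ _).trans hCW) (hS.trans Finset.sdiff_subset)
  · intro T hT hTc
    rcases conn_split (A := (C.erase u : Finset V)) (B := (S : Set V)) hTc
      (by rw [← Finset.coe_union]; exact_mod_cast hT) (by
        intro a ha b hb
        have ha' := Finset.mem_erase.1 (Finset.mem_coe.1 ha)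
        have hb' := Finset.mem_sdiff.1 (hS (Finset.mem_coe.1 hb))
        exact hcut a ha'.2 ha'.1 b hb'.1 hb'.2) (by exact_mod_cast hd) with h | h
    · exact hind T (by exact_mod_cast h) hTc
    · exact hSi T (by exact_mod_cast h) hTc
  · rw [Finset.card_union_of_disjoint hd, Finset.card_erase_of_mem huC]
    omega

lemma main {V : Type*} [Fintype V] (G : SimpleGraph V) :
    ∃ S : Finset V, G.IsGenIndepSet 4 S ∧
      (3 : ℤ) * ((Nat.card V : ℤ) - G.cycleDim) ≤ 4 * S.card := by
  classical
  obtain ⟨F, hFG, hF, hreach⟩ := G.exists_isAcyclic_reachable_eq_le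
  have hcc : Nat.card F.ConnectedComponent = Nat.card G.ConnectedComponent := by
    unfold SimpleGraph.ConnectedComponent
    rw [hreach]
  have h1 := card_le F
  rw [hcc] at h1
  have hsub : F.edgeFinset ⊆ G.edgeFinset := edgeFinset_subset_edgeFinset.2 hFG
  let D : Finset V := (G.edgeFinset \ F.edgeFinset).image fun e => e.out.1
  have hD : D.card ≤ G.edgeFinset.card - F.edgeFinset.card := by
    rw [← Finset.card_sdiff_of_subset hsub]
    exact Finset.card_image_le
  have hle := Finset.card_le_card hsub
  have hDV : Dᶜ.card = Fintype.card V - D.card := Finset.card_compl D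
  obtain ⟨S, hSD, hSi, hSc⟩ := forest hF _ Dᶜ rfl
  refine ⟨S, ?_, ?_⟩
  · intro T hT hTc
    refine hSi T hT ?_
    have : F.induce (T : Set V) = G.induce (T : Set V) := by
      ext ⟨a, ha⟩ ⟨b, hb⟩
      simp only [comap_adj, Function.Embedding.subtype_apply]
      refine ⟨fun h => hFG h, fun h => ?_⟩
      by_contra hn
      have hm : (s(a, b)).out.1 ∈ D := by
        refine Finset.mem_image.2 ⟨s(a, b), ?_, rfl⟩
        simp [h, hn]
      have hm2 : (s(a, b)).out.1 ∈ s(a, b) := Sym2.out_fst_mem _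
      rw [Sym2.mem_iff] at hm2
      rcases hm2 with h' | h'
      · rw [h'] at hm
        exact Finset.mem_compl.1 (hSD (hT (by simpa using ha))) hm
      · rw [h'] at hm
        exact Finset.mem_compl.1 (hSD (hT (by simpa using hb))) hm
    rw [this]; exact hTc
  · unfold SimpleGraph.cycleDim
    simp only [Nat.card_eq_fintype_card (α := V), Nat.card_eq_fintype_card (α := F.edgeSet),
      Nat.card_eq_fintype_card (α := G.edgeSet), ← edgeFinset_card] at h1 ⊢
    omega

end GenIndepAux

/-- For any graph `G` on `n` vertices, `α₄(G) ≥ (3/4)(n - ω(G))`. -/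
theorem genIndepNum_ge {V : Type*} [Fintype V] (G : SimpleGraph V) :
    (G.genIndepNum 4 : ℚ) ≥ 3 / 4 * ((Nat.card V : ℚ) - (G.cycleDim : ℚ)) := by
  obtain ⟨S, hS, hc⟩ := GenIndepAux.main G
  have hle : S.card ≤ G.genIndepNum 4 := by
    refine le_csSup ⟨Fintype.card V, ?_⟩ ⟨S, hS, rfl⟩
    rintro n ⟨T, -, rfl⟩
    exact Finset.card_le_univ T
  have hc' : (3 : ℚ) * ((Nat.card V : ℚ) - G.cycleDim) ≤ 4 * S.card := by exact_mod_cast hc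
  have hle' : (S.card : ℚ) ≤ G.genIndepNum 4 := by exact_mod_cast hle
  linarith
end

section
/- Suppose G is a connected graph with n vertices satisfying α_4(G) = (3/4)(n − ω(G)), and x is a vertex of G lying on some cycle. Then α_4(G − x) = α_4(G) and ω(G − x) = ω(G) − 1, and G − x also satisfies α_4(G − x) = (3/4)((n−1) − ω(G − x)). -/
namespace GoodDel

open SimpleGraph Finset

universe u

/-- A combinatorial consequence of connectedness: every proper nonempty part has an outgoing edge. -/
def Conn {V : Type u} (G : SimpleGraph V) (T : Finset V) : Prop :=
  ∀ A : Finset V, A ⊆ T → A.Nonempty → A ≠ T → ∃ a ∈ A, ∃ b ∈ T, b ∉ A ∧ G.Adj a b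

lemma conn_of_connected {V : Type u} (G : SimpleGraph V) (T : Finset V)
    (h : (G.induce (T : Set V)).Connected) : Conn G T := by
  intro A hA hne hAT
  obtain ⟨a, ha⟩ := hne
  obtain ⟨b, hbT, hbA⟩ : ∃ b ∈ T, b ∉ A := by
    by_contra! hc
    exact hAT (Finset.Subset.antisymm hA hc)
  obtain ⟨p⟩ := h.preconnected ⟨a, hA ha⟩ ⟨b, hbT⟩
  obtain ⟨d, -, h1, h2⟩ := p.exists_boundary_dart {z | (z : V) ∈ A} ha hbA
  exact ⟨d.fst, h1, d.snd, d.snd.2, h2, d.adj⟩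

lemma exists_leaf {V : Type u} [Finite V] [Nonempty V] (G : SimpleGraph V) (h : G.IsAcyclic) :
    ∃ v, ∀ a b, G.Adj v a → G.Adj v b → a = b := by
  classical
  have := Fintype.ofFinite V
  obtain ⟨v0⟩ := ‹Nonempty V›
  set c := G.connectedComponentMk v0 with hc
  have ht := h.isTree_connectedComponent c
  have key : ∃ v : c, ∀ a b, c.toSimpleGraph.Adj v a → c.toSimpleGraph.Adj v b → a = b := by
    rcases subsingleton_or_nontrivial c with hs | hn
    · exact ⟨⟨v0, rfl⟩, fun a b _ _ => Subsingleton.elim _ _⟩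
    · obtain ⟨v, hv⟩ := ht.exists_vert_degree_one_of_nontrivial
      rw [degree_eq_one_iff_existsUnique_adj] at hv
      exact ⟨v, fun a b ha hb => hv.unique ha hb⟩
  obtain ⟨⟨v, hv⟩, hk⟩ := key
  have mem : ∀ a, G.Adj v a → a ∈ c := fun a ha => by
    have : G.connectedComponentMk v = c := hv
    show G.connectedComponentMk a = c
    rw [← this]
    exact ConnectedComponent.sound ha.symm.reachable
  refine ⟨v, fun a b ha hb => ?_⟩
  have := hk ⟨a, mem a ha⟩ ⟨b, mem b hb⟩ ha hb
  exact congrArg Subtype.val this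

lemma exists_leaf_on {V : Type u} (G : SimpleGraph V) (h : G.IsAcyclic) (A : Finset V)
    (hA : A.Nonempty) : ∃ v ∈ A, ∀ a ∈ A, ∀ b ∈ A, G.Adj v a → G.Adj v b → a = b := by
  have : Nonempty (A : Set V) := hA.to_subtype
  have : Finite (A : Set V) := A.finite_toSet
  obtain ⟨v, hv⟩ := exists_leaf (G.induce (A : Set V)) (h.induce _)
  refine ⟨v, v.2, fun a ha b hb h1 h2 => ?_⟩
  exact congrArg Subtype.val (hv ⟨a, ha⟩ ⟨b, hb⟩ h1 h2)

lemma weighted {V : Type u} [DecidableEq V] (G : SimpleGraph V) (h : G.IsAcyclic) :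
    ∀ (n : ℕ) (A : Finset V) (w : V → ℕ), A.card = n → (∀ v, w v ≤ 3) →
      ∃ D ⊆ A, 4 * D.card ≤ ∑ v ∈ A, w v ∧
        ∀ T ⊆ A \ D, Conn G T → ∑ v ∈ T, w v ≤ 3 := by
  intro n
  induction n using Nat.strong_induction_on with
  | _ n ih =>
  intro A w hn hw
  rcases A.eq_empty_or_nonempty with rfl | hA
  · refine ⟨∅, by simp, by simp, fun T hT _ => ?_⟩
    have : T = ∅ := by simpa using hT
    simp [this]
  obtain ⟨v, hvA, hv⟩ := exists_leaf_on G h A hA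
  -- a connected set containing `v` with no neighbour of `v` is `{v}`
  have single : ∀ T : Finset V, Conn G T → v ∈ T → (∀ b ∈ T, ¬ G.Adj v b) →
      ∑ z ∈ T, w z ≤ 3 := by
    intro T hT hvT hno
    by_cases hTe : {v} = T
    · rw [← hTe]; simpa using hw v
    · obtain ⟨a, ha, b, hb, -, hab⟩ := hT {v} (by simpa using hvT) (by simp) hTe
      simp only [Finset.mem_singleton] at ha
      subst ha
      exact absurd hab (hno b hb)
  have hcard : (A.erase v).card < n := by
    rw [Finset.card_erase_of_mem hvA]
    have := Finset.card_pos.2 hA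
    omega
  by_cases hu : ∃ u ∈ A, G.Adj v u
  · obtain ⟨u, huA, huv⟩ := hu
    have huvne : u ≠ v := huv.ne'
    have huA' : u ∈ A.erase v := Finset.mem_erase.2 ⟨huvne, huA⟩
    have only : ∀ b ∈ A, G.Adj v b → b = u := fun b hb hvb => hv b hb u huA hvb huv
    have hs1 := Finset.add_sum_erase A w hvA
    have hs2 := Finset.add_sum_erase (A.erase v) w huA'
    by_cases hsum : w u + w v ≤ 3
    · -- merge `v` into `u`
      obtain ⟨D, hDA, hD, hT⟩ := ih _ hcard (A.erase v) (Function.update w u (w u + w v)) rfl (by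
        intro z
        by_cases hz : z = u
        · subst hz; simpa using hsum
        · simpa [Function.update_of_ne hz] using hw z)
      have hsumB : ∀ B : Finset V, u ∈ B →
          ∑ z ∈ B, Function.update w u (w u + w v) z = ∑ z ∈ B, w z + w v := by
        intro B hB
        rw [← Finset.add_sum_erase B _ hB, ← Finset.add_sum_erase B w hB]
        rw [Finset.sum_congr rfl (g := w) (fun z hz => by
          rw [Function.update_of_ne (Finset.ne_of_mem_erase hz)])]
        rw [Function.update_self]
        ring
      refine ⟨D, hDA.trans (Finset.erase_subset _ _), ?_, ?_⟩
      · rw [hsumB _ huA'] at hD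
        omega
      · intro T hTA hTc
        have hTA' : ∀ z ∈ T, z ∈ A := fun z hz => (Finset.mem_sdiff.1 (hTA hz)).1
        have hTD : ∀ z ∈ T, z ∉ D := fun z hz => (Finset.mem_sdiff.1 (hTA hz)).2
        by_cases hvT : v ∈ T
        · by_cases huT : u ∈ T
          · have hc : Conn G (T.erase v) := by
              intro B hB hBne hBT
              have hBT' : ∀ z ∈ B, z ∈ T ∧ z ≠ v := fun z hz =>
                ⟨Finset.mem_of_mem_erase (hB hz), Finset.ne_of_mem_erase (hB hz)⟩
              by_cases huB : u ∈ B
              · obtain ⟨a, ha, b, hb, hbB, hab⟩ := hTc (insert v B)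
                  (by
                    intro z hz
                    rcases Finset.mem_insert.1 hz with rfl | hz
                    · exact hvT
                    · exact (hBT' z hz).1) (by simp) (by
                    intro he
                    apply hBT
                    rw [← he, Finset.erase_insert]
                    intro hvB
                    exact (hBT' v hvB).2 rfl)
                rw [Finset.mem_insert, not_or] at hbB
                rcases Finset.mem_insert.1 ha with rfl | ha
                · exact absurd (only b (hTA' b hb) hab ▸ huB) hbB.2
                · exact ⟨a, ha, b, Finset.mem_erase.2 ⟨hbB.1, hb⟩, hbB.2, hab⟩
              · obtain ⟨a, ha, b, hb, hbB, hab⟩ := hTc B (fun z hz => (hBT' z hz).1) hBne (by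
                  rintro rfl
                  exact huB huT)
                refine ⟨a, ha, b, Finset.mem_erase.2 ⟨?_, hb⟩, hbB, hab⟩
                rintro rfl
                exact huB (only a (hTA' a (hBT' a ha).1) hab.symm ▸ ha)
            have := hT (T.erase v) (by
              intro z hz
              have hzT := Finset.mem_of_mem_erase hz
              exact Finset.mem_sdiff.2 ⟨Finset.mem_erase.2 ⟨Finset.ne_of_mem_erase hz,
                hTA' z hzT⟩, hTD z hzT⟩) hc
            rw [hsumB _ (Finset.mem_erase.2 ⟨huvne, huT⟩)] at this
            rw [← Finset.add_sum_erase T w hvT]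
            omega
          · exact single T hTc hvT (fun b hb hvb => huT (only b (hTA' b hb) hvb ▸ hb))
        · refine le_trans (Finset.sum_le_sum fun z _ => ?_) (hT T (by
            intro z hz
            exact Finset.mem_sdiff.2 ⟨Finset.mem_erase.2 ⟨fun hzv => hvT (hzv ▸ hz),
              hTA' z hz⟩, hTD z hz⟩) hTc)
          by_cases hz : z = u
          · subst hz; simp
          · rw [Function.update_of_ne hz]
    · -- delete `u`
      have hcard2 : ((A.erase v).erase u).card < n :=
        lt_of_le_of_lt (Finset.card_le_card (Finset.erase_subset _ _)) hcard
      obtain ⟨D, hDA, hD, hT⟩ := ih _ hcard2 ((A.erase v).erase u) w rfl hw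
      refine ⟨insert u D, ?_, ?_, ?_⟩
      · intro z hz
        rcases Finset.mem_insert.1 hz with rfl | hz
        · exact huA
        · exact Finset.mem_of_mem_erase (Finset.mem_of_mem_erase (hDA hz))
      · have := Finset.card_insert_le u D
        omega
      · intro T hTA hTc
        have hTA' : ∀ z ∈ T, z ∈ A := fun z hz => (Finset.mem_sdiff.1 (hTA hz)).1
        have hTD : ∀ z ∈ T, z ≠ u ∧ z ∉ D := fun z hz => by
          have := (Finset.mem_sdiff.1 (hTA hz)).2
          rwa [Finset.mem_insert, not_or] at this
        by_cases hvT : v ∈ T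
        · exact single T hTc hvT (fun b hb hvb => (hTD b hb).1 (only b (hTA' b hb) hvb))
        · refine hT T ?_ hTc
          intro z hz
          exact Finset.mem_sdiff.2 ⟨Finset.mem_erase.2 ⟨(hTD z hz).1,
            Finset.mem_erase.2 ⟨fun hzv => hvT (hzv ▸ hz), hTA' z hz⟩⟩, (hTD z hz).2⟩
  · push Not at hu
    obtain ⟨D, hDA, hD, hT⟩ := ih _ hcard (A.erase v) w rfl hw
    refine ⟨D, hDA.trans (Finset.erase_subset _ _), ?_, ?_⟩
    · have hs1 := Finset.add_sum_erase A w hvA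
      omega
    · intro T hTA hTc
      have hTA' : ∀ z ∈ T, z ∈ A := fun z hz => (Finset.mem_sdiff.1 (hTA hz)).1
      by_cases hvT : v ∈ T
      · exact single T hTc hvT (fun b hb => hu b (hTA' b hb))
      · refine hT T ?_ hTc
        intro z hz
        exact Finset.mem_sdiff.2 ⟨Finset.mem_erase.2 ⟨fun hzv => hvT (hzv ▸ hz),
          hTA' z hz⟩, (Finset.mem_sdiff.1 (hTA hz)).2⟩

/-! ### genIndepNum -/

lemma bdd {V : Type u} [Fintype V] (G : SimpleGraph V) (k : ℕ) :
    BddAbove {n | ∃ S : Finset V, G.IsGenIndepSet k S ∧ S.card = n} := by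
  refine ⟨Fintype.card V, ?_⟩
  rintro n ⟨S, -, rfl⟩
  exact S.card_le_univ

lemma le_num {V : Type u} [Fintype V] (G : SimpleGraph V) (k : ℕ) (S : Finset V)
    (hS : G.IsGenIndepSet k S) : S.card ≤ G.genIndepNum k :=
  le_csSup (bdd G k) ⟨S, hS, rfl⟩

lemma num_induce_le {V : Type u} [Fintype V] (G : SimpleGraph V) (s : Set V) :
    (G.induce s).genIndepNum 4 ≤ G.genIndepNum 4 := by
  classical
  refine csSup_le ⟨0, ∅, ?_, rfl⟩ ?_
  · intro T hT _
    have : T = ∅ := by simpa using hT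
    simp [this]
  rintro n ⟨S, hS, rfl⟩
  rw [← Finset.card_map (Function.Embedding.subtype (· ∈ s))]
  refine le_num G 4 _ ?_
  intro T hT hTc
  have hTs : ∀ z ∈ T, z ∈ s := fun z hz => by
    obtain ⟨y, -, rfl⟩ := Finset.mem_map.1 (hT hz)
    exact y.2
  let T' : Finset s := T.subtype (· ∈ s)
  have hT' : T' ⊆ S := by
    intro z hz
    obtain ⟨y, hy, hyz⟩ := Finset.mem_map.1 (hT (Finset.mem_subtype.1 hz))
    have : y = z := Subtype.ext hyz
    exact this ▸ hy
  have hcard : T'.card = T.card := by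
    rw [← Finset.card_map (Function.Embedding.subtype (· ∈ s))]
    congr 1
    exact Finset.subtype_map_of_mem hTs
  rw [← hcard]
  refine hS T' hT' ?_
  let f : G.induce (T : Set V) →g (G.induce s).induce (T' : Set s) :=
    { toFun := fun z => ⟨⟨z.1, hTs _ z.2⟩, Finset.mem_coe.2 (Finset.mem_subtype.2 z.2)⟩
      map_rel' := fun {a b} hab => hab }
  refine hTc.map f ?_
  rintro ⟨⟨z, hz⟩, hzT⟩
  exact ⟨⟨z, Finset.mem_subtype.1 hzT⟩, rfl⟩

/-! ### cycleDim -/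

lemma reach_delete {V : Type u} (G : SimpleGraph V) (u v a b : V) (h : G.Reachable a b) :
    (G.deleteEdges {s(u, v)}).Reachable a b ∨
    ((G.deleteEdges {s(u, v)}).Reachable a u ∧ (G.deleteEdges {s(u, v)}).Reachable b v) ∨
    ((G.deleteEdges {s(u, v)}).Reachable a v ∧ (G.deleteEdges {s(u, v)}).Reachable b u) := by
  obtain ⟨p⟩ := h
  induction p with
  | nil => exact Or.inl (Reachable.refl _)
  | @cons a c b hac p ih =>
    by_cases he : s(a, c) = s(u, v)
    · rw [Sym2.eq_iff] at he
      rcases he with ⟨rfl, rfl⟩ | ⟨rfl, rfl⟩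
      · rcases ih with h | ⟨h1, h2⟩ | ⟨h1, h2⟩
        · exact Or.inr (Or.inl ⟨Reachable.refl _, h.symm⟩)
        · exact Or.inr (Or.inl ⟨Reachable.refl _, h2⟩)
        · exact Or.inl h2.symm
      · rcases ih with h | ⟨h1, h2⟩ | ⟨h1, h2⟩
        · exact Or.inr (Or.inr ⟨Reachable.refl _, h.symm⟩)
        · exact Or.inl h2.symm
        · exact Or.inr (Or.inr ⟨Reachable.refl _, h2⟩)
    · have hadj : (G.deleteEdges {s(u, v)}).Reachable a c :=
        Adj.reachable (by rw [deleteEdges_adj]; exact ⟨hac, by simpa using he⟩)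
      rcases ih with h | ⟨h1, h2⟩ | ⟨h1, h2⟩
      · exact Or.inl (hadj.trans h)
      · exact Or.inr (Or.inl ⟨hadj.trans h1, h2⟩)
      · exact Or.inr (Or.inr ⟨hadj.trans h1, h2⟩)

lemma card_edge_delete {V : Type u} [Finite V] (G : SimpleGraph V) (u v : V) (h : G.Adj u v) :
    Nat.card G.edgeSet = Nat.card (G.deleteEdges {s(u, v)}).edgeSet + 1 := by
  have hm : s(u, v) ∈ G.edgeSet := h
  rw [edgeSet_deleteEdges, Nat.card_coe_set_eq, Nat.card_coe_set_eq,
    Set.ncard_sdiff_singleton_add_one hm (Set.toFinite _)]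

lemma card_comp_delete {V : Type u} [Finite V] (G : SimpleGraph V) (u v : V) :
    Nat.card (G.deleteEdges {s(u, v)}).ConnectedComponent ≤ Nat.card G.ConnectedComponent + 1 := by
  classical
  rw [← Finite.card_option]
  have hr0 := reach_delete G u v
  have hle : G.deleteEdges {s(u, v)} ≤ G := deleteEdges_le _
  generalize G.deleteEdges {s(u, v)} = H at *
  refine Nat.card_le_card_of_injective
    (fun c : H.ConnectedComponent => if c = H.connectedComponentMk v then none else
      some (c.map (Hom.ofLE hle))) ?_
  intro c d
  induction c using ConnectedComponent.ind with | _ a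
  induction d using ConnectedComponent.ind with | _ b
  intro hcd
  by_cases h1 : H.connectedComponentMk a = H.connectedComponentMk v
  · by_cases h2 : H.connectedComponentMk b = H.connectedComponentMk v
    · rw [h1, h2]
    · simp [h1, h2] at hcd
  · by_cases h2 : H.connectedComponentMk b = H.connectedComponentMk v
    · simp [h1, h2] at hcd
    · simp only [h1, h2, if_false, Option.some.injEq, ConnectedComponent.map_mk] at hcd
      have hr : G.Reachable a b := ConnectedComponent.exact hcd
      rcases hr0 a b hr with h | ⟨_, h⟩ | ⟨h, _⟩
      · exact ConnectedComponent.sound h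
      · exact absurd (ConnectedComponent.sound h) h2
      · exact absurd (ConnectedComponent.sound h) h1

lemma card_comp_delete' {V : Type u} [Finite V] (G : SimpleGraph V) (u v : V)
    (huv : (G.deleteEdges {s(u, v)}).Reachable u v) :
    Nat.card (G.deleteEdges {s(u, v)}).ConnectedComponent ≤ Nat.card G.ConnectedComponent := by
  have hr0 := reach_delete G u v
  have hle : G.deleteEdges {s(u, v)} ≤ G := deleteEdges_le _
  generalize G.deleteEdges {s(u, v)} = H at *
  refine Nat.card_le_card_of_injective
    (fun c : H.ConnectedComponent => c.map (Hom.ofLE hle)) ?_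
  intro c d
  induction c using ConnectedComponent.ind with | _ a
  induction d using ConnectedComponent.ind with | _ b
  intro hcd
  have hr : G.Reachable a b := ConnectedComponent.exact hcd
  rcases hr0 a b hr with h | ⟨h, h'⟩ | ⟨h, h'⟩
  · exact ConnectedComponent.sound h
  · exact ConnectedComponent.sound (h.trans (huv.trans h'.symm))
  · exact ConnectedComponent.sound (h.trans (huv.symm.trans h'.symm))

lemma cycleDim_mono {V : Type u} [Finite V] (H : SimpleGraph V) :
    ∀ (n : ℕ) (G : SimpleGraph V), Nat.card G.edgeSet = n → H ≤ G → H.cycleDim ≤ G.cycleDim := by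
  intro n
  induction n using Nat.strong_induction_on with
  | _ n ih =>
  intro G hn hle
  by_cases hGH : G ≤ H
  · rw [le_antisymm hle hGH]
  · obtain ⟨u, v, huv, hnot⟩ : ∃ u v, G.Adj u v ∧ ¬ H.Adj u v := by
      by_contra! hc
      exact hGH fun u v => hc u v
    have h1 := card_edge_delete G u v huv
    have h2 := card_comp_delete G u v
    have h3 := ih _ (by omega) (G.deleteEdges {s(u, v)}) rfl (by
      intro a b hab
      rw [deleteEdges_adj]
      refine ⟨hle hab, ?_⟩
      simp only [Set.mem_singleton_iff]
      intro he
      apply hnot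
      rw [← mem_edgeSet, ← he]
      exact hab)
    refine h3.trans ?_
    unfold SimpleGraph.cycleDim
    omega

lemma cycleDim_nonneg {V : Type u} [Finite V] (G : SimpleGraph V) : 0 ≤ G.cycleDim := by
  refine le_trans ?_ (cycleDim_mono ⊥ _ G rfl bot_le)
  unfold SimpleGraph.cycleDim
  have : Nat.card V ≤ Nat.card (⊥ : SimpleGraph V).ConnectedComponent := by
    refine Nat.card_le_card_of_injective (fun v => (⊥ : SimpleGraph V).connectedComponentMk v) ?_
    intro a b hab
    exact reachable_bot.1 (ConnectedComponent.exact hab)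
  omega

lemma cycleDim_induce_le {V : Type u} [Finite V] (G : SimpleGraph V) (x : V) :
    (G.induce {u | u ≠ x}).cycleDim ≤ (G.deleteIncidenceSet x).cycleDim := by
  classical
  have hV : Nat.card V = Nat.card {u | u ≠ x} + 1 := by
    rw [Nat.card_coe_set_eq, show {u | u ≠ x} = ({x}ᶜ : Set V) from rfl,
      ← Set.ncard_singleton x, Set.ncard_compl_add_ncard]
  have hE : Nat.card (G.induce {u | u ≠ x}).edgeSet ≤ Nat.card (G.deleteIncidenceSet x).edgeSet := by
    let f : G.induce {u | u ≠ x} →g G.deleteIncidenceSet x :=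
      { toFun := Subtype.val
        map_rel' := fun {a b} hab => deleteIncidenceSet_adj.2 ⟨hab, a.2, b.2⟩ }
    exact Nat.card_le_card_of_injective f.mapEdgeSet
      (Hom.mapEdgeSet.injective f Subtype.val_injective)
  have hC : Nat.card (G.induce {u | u ≠ x}).ConnectedComponent + 1 ≤
      Nat.card (G.deleteIncidenceSet x).ConnectedComponent := by
    rw [← Finite.card_option]
    let g : V → Option (G.induce {u | u ≠ x}).ConnectedComponent := fun v =>
      if h : v = x then none else some ((G.induce {u | u ≠ x}).connectedComponentMk ⟨v, h⟩)
    have hg : ∀ a b, (G.deleteIncidenceSet x).Walk a b → g a = g b := by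
      intro a b p
      induction p with
      | nil => rfl
      | @cons a c b hac p ih =>
        rw [← ih]
        obtain ⟨h1, h2, h3⟩ := deleteIncidenceSet_adj.1 hac
        simp only [g, dif_neg h2, dif_neg h3]
        congr 1
        refine ConnectedComponent.sound (Adj.reachable ?_)
        exact h1
    refine Nat.card_le_card_of_surjective
      (ConnectedComponent.lift g (fun a b p _ => hg a b p)) ?_
    intro o
    rcases o with _ | c
    · refine ⟨(G.deleteIncidenceSet x).connectedComponentMk x, ?_⟩
      simp [g]
    · induction c using ConnectedComponent.ind with | _ a
      refine ⟨(G.deleteIncidenceSet x).connectedComponentMk a, ?_⟩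
      have : (a : V) ≠ x := a.2
      simp [g, this]
  unfold SimpleGraph.cycleDim
  omega

lemma cycleDim_delete {V : Type u} [Finite V] (G : SimpleGraph V) (x : V)
    (hx : ∃ c : G.Walk x x, c.IsCycle) :
    (G.induce {u | u ≠ x}).cycleDim ≤ G.cycleDim - 1 := by
  obtain ⟨c, hc⟩ := hx
  cases c with
  | nil => exact absurd hc (by simp)
  | @cons _ y _ hxy p =>
    have hr : (G.deleteEdges {s(x, y)}).Reachable x y :=
      (adj_and_reachable_delete_edges_iff_exists_cycle.2
        ⟨x, _, hc, by simp⟩).2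
    have h1 := card_edge_delete G x y hxy
    have h2 := card_comp_delete' G x y hr
    have h3 := cycleDim_mono (G.deleteIncidenceSet x) _ (G.deleteEdges {s(x, y)}) rfl (by
      intro a b hab
      obtain ⟨h1, h2, h3⟩ := deleteIncidenceSet_adj.1 hab
      rw [deleteEdges_adj]
      refine ⟨h1, ?_⟩
      simp only [Set.mem_singleton_iff, Sym2.eq_iff]
      tauto)
    refine (cycleDim_induce_le G x).trans (h3.trans ?_)
    unfold SimpleGraph.cycleDim
    omega

/-- The lower bound `4 α₄(G) ≥ 3 (n - ω(G))`. -/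
lemma lower : ∀ (n : ℕ) (V : Type u) [Fintype V] (G : SimpleGraph V), Nat.card V = n →
    3 * ((n : ℤ) - G.cycleDim) ≤ 4 * (G.genIndepNum 4 : ℤ) := by
  classical
  intro n
  induction n with
  | zero =>
    intro V _ G _
    have := cycleDim_nonneg G
    omega
  | succ n ih =>
  intro V _ G hn
  by_cases hG : G.IsAcyclic
  · obtain ⟨D, -, hD, hT⟩ := weighted G hG _ Finset.univ (fun _ => 1) rfl (by simp)
    have h0 := cycleDim_nonneg G
    have hS := le_num G 4 (Finset.univ \ D) (by
      intro T hTs hTc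
      have := hT T hTs (conn_of_connected G T hTc)
      simp at this
      omega)
    have hc := Finset.card_sdiff_add_card_eq_card (Finset.subset_univ D)
    rw [Finset.card_univ, ← Nat.card_eq_fintype_card] at hc
    simp [← Nat.card_eq_fintype_card] at hD
    omega
  · obtain ⟨x, c, hc⟩ : ∃ x, ∃ c : G.Walk x x, c.IsCycle := by
      by_contra! hcon
      exact hG fun x c => hcon x c
    have h1 := cycleDim_delete G x ⟨c, hc⟩
    have hV : Nat.card V = Nat.card {u | u ≠ x} + 1 := by
      rw [Nat.card_coe_set_eq, show {u | u ≠ x} = ({x}ᶜ : Set V) from rfl,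
        ← Set.ncard_singleton x, Set.ncard_compl_add_ncard]
    have h2 := ih {u | u ≠ x} (G.induce {u | u ≠ x}) (by omega)
    have h3 := num_induce_le G {u | u ≠ x}
    push_cast
    omega

end GoodDel

/-- If a connected graph `G` on `n` vertices attains `α₄(G) = (3/4)(n - ω(G))` and `x` lies
on a cycle, then deleting `x` preserves `α₄`, decreases `ω` by exactly one, and the
resulting graph again attains the bound. -/
theorem good_deleteVertex {V : Type*} [Fintype V] (G : SimpleGraph V)
    (hconn : G.Connected)
    (hgood : (G.genIndepNum 4 : ℚ) = 3 / 4 * ((Nat.card V : ℚ) - (G.cycleDim : ℚ)))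
    (x : V) (hx : ∃ c : G.Walk x x, c.IsCycle) :
    (G.induce {u | u ≠ x}).genIndepNum 4 = G.genIndepNum 4 ∧
      (G.induce {u | u ≠ x}).cycleDim = G.cycleDim - 1 ∧
      ((G.induce {u | u ≠ x}).genIndepNum 4 : ℚ) =
        3 / 4 * (((Nat.card V : ℚ) - 1) - ((G.induce {u | u ≠ x}).cycleDim : ℚ)) := by
  classical
  have h1 := GoodDel.cycleDim_delete G x hx
  have hV : Nat.card V = Nat.card {u | u ≠ x} + 1 := by
    rw [Nat.card_coe_set_eq, show {u | u ≠ x} = ({x}ᶜ : Set V) from rfl,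
      ← Set.ncard_singleton x, Set.ncard_compl_add_ncard]
  have h2 := GoodDel.lower _ {u | u ≠ x} (G.induce {u | u ≠ x}) rfl
  have h3 := GoodDel.num_induce_le G {u | u ≠ x}
  have hgood' : 4 * (G.genIndepNum 4 : ℤ) = 3 * ((Nat.card V : ℤ) - G.cycleDim) := by
    have : (4 * (G.genIndepNum 4 : ℤ) : ℚ) = 3 * ((Nat.card V : ℚ) - (G.cycleDim : ℚ)) := by
      rw [Int.cast_natCast, hgood]; ring
    exact_mod_cast this
  have e1 : (G.induce {u | u ≠ x}).genIndepNum 4 = G.genIndepNum 4 := by omega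
  have e2 : (G.induce {u | u ≠ x}).cycleDim = G.cycleDim - 1 := by omega
  refine ⟨e1, e2, ?_⟩
  rw [e1, e2, hgood]
  push_cast
  ring
end

section
/- Suppose G is a graph with n vertices satisfying α_4(G) = (3/4)(n − ω(G)). Then no vertex lying on a cycle of G is adjacent to a pendant vertex of G. -/
namespace GoodAux

open SimpleGraph

/-- A connected set that meets `A`, and is closed in `A` under adjacency, lies inside `A`. -/
lemma subset_of_closed {V : Type*} {G : SimpleGraph V} {T : Set V}
    (hT : (G.induce T).Connected) (A : Set V) {a : V} (haT : a ∈ T) (haA : a ∈ A)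
    (hcl : ∀ u ∈ T, u ∈ A → ∀ w ∈ T, G.Adj u w → w ∈ A) : T ⊆ A := by
  intro b hb
  by_contra hbA
  obtain ⟨p⟩ := hT.preconnected ⟨a, haT⟩ ⟨b, hb⟩
  obtain ⟨d, -, h1, h2⟩ := p.exists_boundary_dart {t | (t : V) ∈ A} haA hbA
  exact h2 (hcl _ d.fst.2 h1 _ d.snd.2 d.adj)

/-- The number of vertices is at most the number of edges plus the number of components. -/
lemma card_le_edges_add_comps {V : Type*} [Finite V] (G : SimpleGraph V) :
    Nat.card V ≤ Nat.card G.edgeSet + Nat.card G.ConnectedComponent := by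
  classical
  have hrep : ∀ c : G.ConnectedComponent, ∃ v, G.connectedComponentMk v = c := fun c => c.exists_rep
  choose r hr using hrep
  let R : V → V := fun v => r (G.connectedComponentMk v)
  have hR : ∀ v, G.Reachable v (R v) := fun v =>
    (ConnectedComponent.exact (hr (G.connectedComponentMk v))).symm
  have hRadj : ∀ v w, G.Adj v w → R v = R w := fun v w h => by
    simp only [R, ConnectedComponent.sound h.reachable]
  have hnext : ∀ v, ∃ w, v ≠ R v → G.Adj v w ∧ G.dist w (R v) < G.dist v (R v) := by
    intro v
    by_cases hv : v = R v
    · exact ⟨v, fun h => absurd hv h⟩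
    obtain ⟨p, hp⟩ := (hR v).exists_walk_length_eq_dist
    have key : ∀ {b : V} (q : G.Walk v b), v ≠ b → q.length = G.dist v b →
        ∃ w, G.Adj v w ∧ G.dist w b < G.dist v b := by
      intro b q hne hq
      cases q with
      | nil => exact absurd rfl hne
      | cons h q' =>
        refine ⟨_, h, ?_⟩
        have := dist_le q'
        simp only [Walk.length_cons] at hq
        omega
    obtain ⟨w, hw⟩ := key p hv hp
    exact ⟨w, fun _ => hw⟩
  choose nx hnx using hnext
  let f : V → G.edgeSet ⊕ G.ConnectedComponent := fun v =>
    if h : v = R v then Sum.inr (G.connectedComponentMk v)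
    else Sum.inl ⟨s(v, nx v), (hnx v h).1⟩
  have hf : Function.Injective f := by
    intro v w hvw
    by_cases hv : v = R v <;> by_cases hw : w = R w
    · simp only [f, dif_pos hv, dif_pos hw, Sum.inr.injEq] at hvw
      rw [hv, hw]
      simp only [R, hvw]
    · simp [f, dif_pos hv, dif_neg hw] at hvw
    · simp [f, dif_neg hv, dif_pos hw] at hvw
    · simp only [f, dif_neg hv, dif_neg hw, Sum.inl.injEq] at hvw
      have hvw := Sym2.eq_iff.1 (congrArg Subtype.val hvw)
      rcases hvw with h | ⟨h1, h2⟩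
      · exact h.1
      · have e1 := (hnx v hv).2
        have e2 := (hnx w hw).2
        have e3 := hRadj _ _ (hnx v hv).1
        rw [h2] at e1 e3
        rw [← h1, ← e3] at e2
        omega
  calc Nat.card V ≤ Nat.card (G.edgeSet ⊕ G.ConnectedComponent) :=
        Nat.card_le_card_of_injective f hf
    _ = _ := Nat.card_sum

/-- In an acyclic graph a vertex outside a connected set has at most one neighbour in it. -/
lemma unique_nbr {V : Type*} {F : SimpleGraph V} (hF : F.IsAcyclic) {C : Set V}
    (hC : (F.induce C).Connected) {v a b : V} (hv : v ∉ C) (ha : a ∈ C) (hb : b ∈ C)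
    (hva : F.Adj v a) (hvb : F.Adj v b) : a = b := by
  by_contra hab
  have hbr := isAcyclic_iff_forall_adj_isBridge.1 hF hva
  rw [isBridge_iff_forall_walk_mem_edges] at hbr
  obtain ⟨p⟩ := hC.preconnected ⟨b, hb⟩ ⟨a, ha⟩
  let q : F.Walk b a := p.map (Embedding.induce C).toHom
  have hq := hbr (Walk.cons hvb q)
  rw [Walk.edges_cons, List.mem_cons] at hq
  rcases hq with h | h
  · rw [Sym2.eq_iff] at h
    rcases h with h | h
    · exact hab h.2
    · exact hva.ne h.2.symm
  · have h2 := q.fst_mem_support_of_mem_edges h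
    have h3 : q.support = p.support.map (Embedding.induce C).toHom := Walk.support_map _ p
    rw [h3, List.mem_map] at h2
    obtain ⟨t, -, ht⟩ := h2
    exact hv (ht ▸ t.2)

/-- `W` is a connected subset of `U` attached to the rest of `U` only through `v`. -/
def Branch {V : Type*} (F : SimpleGraph V) (U W : Finset V) (v : V) : Prop :=
  W ⊆ U ∧ v ∈ W ∧ (F.induce (W : Set V)).Connected ∧
    ∀ a ∈ W, a ≠ v → ∀ b ∈ U, b ∉ W → ¬ F.Adj a b

/-- Extend a connected set to a maximal connected one inside `P`. -/
lemma exists_max {V : Type*} [DecidableEq V] (F : SimpleGraph V) (P T : Finset V) (hTP : T ⊆ P)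
    (hT : (F.induce (T : Set V)).Connected) :
    ∃ C : Finset V, T ⊆ C ∧ C ⊆ P ∧ (F.induce (C : Set V)).Connected ∧
      ∀ a ∈ C, ∀ b ∈ P, b ∉ C → ¬ F.Adj a b := by
  classical
  let A := P.powerset.filter (fun C => T ⊆ C ∧ (F.induce (C : Set V)).Connected)
  have hA : A.Nonempty := ⟨T, by simp [A, hTP, hT]⟩
  obtain ⟨C, hCA, hmax⟩ := A.exists_max_image Finset.card hA
  simp only [A, Finset.mem_filter, Finset.mem_powerset] at hCA hmax
  refine ⟨C, hCA.2.1, hCA.1, hCA.2.2, ?_⟩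
  intro a ha b hb hbC hab
  have hcon : (F.induce ((insert b C : Finset V) : Set V)).Connected := by
    have := connected_induce_union (G := F) (s := (C : Set V)) (t := {b}) hCA.2.2.preconnected
      (by intro x y; rw [Subsingleton.elim x y]) (Finset.mem_coe.2 ha) rfl hab
    rw [Finset.coe_insert, ← Set.union_singleton]
    exact this
  have := hmax (insert b C) ⟨Finset.insert_subset hb hCA.1,
    hCA.2.1.trans (Finset.subset_insert _ _), hcon⟩
  rw [Finset.card_insert_of_notMem hbC] at this
  omega

/-- Forests have large generalized 4-independent sets. -/
lemma forest_bound {V : Type*} {F : SimpleGraph V} (hF : F.IsAcyclic) :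
    ∀ (n : ℕ) (U : Finset V), U.card = n →
      ∃ S ⊆ U, F.IsGenIndepSet 4 S ∧ 3 * U.card ≤ 4 * S.card := by
  classical
  intro n
  induction n using Nat.strong_induction_on with
  | _ n ih =>
  intro U hU
  by_cases hex : ∃ k : ℕ, ∃ W v, Branch F U W v ∧ 4 ≤ W.card ∧ W.card = k
  · obtain ⟨W, v, hB, h4, hk⟩ := Nat.find_spec hex
    have hmin : ∀ W' v', Branch F U W' v' → W'.card < W.card → W'.card < 4 := by
      intro W' v' hB' hlt
      by_contra hcon
      exact Nat.find_min hex (hk ▸ hlt) ⟨W', v', hB', by omega, rfl⟩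
    obtain ⟨hWU, hvW, hWc, hatt⟩ := hB
    have hsmall : F.IsGenIndepSet 4 (W.erase v) := by
      intro T hT hTc
      obtain ⟨C, hTC, hCP, hCc, hCmax⟩ := exists_max F _ T hT hTc
      have hvC : v ∉ C := fun h => by simpa using hCP h
      have hCW : C ⊆ W := hCP.trans (Finset.erase_subset _ _)
      have hlt : C.card < W.card :=
        Finset.card_lt_card (Finset.ssubset_iff_subset_ne.2 ⟨hCW, fun h => hvC (h ▸ hvW)⟩)
      have hu : ∃ u ∈ C, ∀ a ∈ C, F.Adj a v → a = u := by
        by_cases h : ∃ u ∈ C, F.Adj u v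
        · obtain ⟨u, hu, huv⟩ := h
          exact ⟨u, hu, fun a ha hav =>
            unique_nbr hF hCc (by simpa using hvC) (Finset.mem_coe.2 ha) (Finset.mem_coe.2 hu)
              hav.symm huv.symm⟩
        · obtain ⟨⟨u, hu⟩⟩ := hCc.nonempty
          exact ⟨u, hu, fun a ha hav => absurd ⟨a, ha, hav⟩ h⟩
      obtain ⟨u, huC, huu⟩ := hu
      refine (Finset.card_le_card hTC).trans_lt (hmin C u ⟨hCW.trans hWU, huC, hCc, ?_⟩ hlt)
      intro a ha hau b hb hbC hab
      by_cases hbW : b ∈ W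
      · by_cases hbv : b = v
        · subst hbv
          exact hau (huu a ha hab)
        · exact hCmax a ha b (Finset.mem_erase.2 ⟨hbv, hbW⟩) hbC hab
      · exact hatt a (hCW ha) (fun h => hvC (h ▸ ha)) b hb hbW hab
    have hcard := Finset.card_sdiff_add_card_eq_card hWU
    obtain ⟨S, hSU, hS, hSc⟩ := ih (U \ W).card (by omega) (U \ W) rfl
    have hdisj : Disjoint S (W.erase v) := by
      rw [Finset.disjoint_left]
      intro a ha hb
      exact (Finset.mem_sdiff.1 (hSU ha)).2 (Finset.mem_of_mem_erase hb)
    refine ⟨S ∪ W.erase v, ?_, ?_, ?_⟩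
    · exact Finset.union_subset (hSU.trans Finset.sdiff_subset)
        ((Finset.erase_subset _ _).trans hWU)
    · intro T hT hTc
      have hno : ∀ a ∈ S, ∀ b ∈ W.erase v, ¬ F.Adj b a := by
        intro a ha b hb
        have ha' := Finset.mem_sdiff.1 (hSU ha)
        exact hatt b (Finset.mem_of_mem_erase hb) (Finset.ne_of_mem_erase hb) a ha'.1 ha'.2
      by_cases h : ∃ a ∈ T, a ∈ S
      · obtain ⟨a, haT, haS⟩ := h
        refine hS T (Finset.coe_subset.1 (subset_of_closed hTc (S : Set V) haT haS ?_)) hTc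
        intro u huT huS w hwT huw
        rcases Finset.mem_union.1 (hT hwT) with h | h
        · exact h
        · exact absurd huw.symm (hno u huS w h)
      · refine hsmall T (fun a ha => ?_) hTc
        rcases Finset.mem_union.1 (hT ha) with h' | h'
        · exact absurd ⟨a, ha, h'⟩ h
        · exact h'
    · rw [Finset.card_union_of_disjoint hdisj, Finset.card_erase_of_mem hvW]
      omega
  · refine ⟨U, subset_rfl, ?_, by omega⟩
    intro T hT hTc
    obtain ⟨C, hTC, hCP, hCc, hCmax⟩ := exists_max F _ T hT hTc
    obtain ⟨⟨u, hu⟩⟩ := hCc.nonempty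
    by_contra hcon
    exact hex ⟨C.card, C, u, ⟨hCP, hu, hCc, fun a ha _ b hb hbC => hCmax a ha b hb hbC⟩,
      (not_lt.1 hcon).trans (Finset.card_le_card hTC), rfl⟩

/-- A spanning forest avoiding a prescribed non-bridge edge. -/
lemma exists_forest {V : Type*} (G : SimpleGraph V) {x z : V}
    (hxz : (G.deleteEdges {s(x, z)}).Reachable x z) :
    ∃ F ≤ G, F.IsAcyclic ∧ ¬ F.Adj x z ∧ F.Reachable = G.Reachable := by
  obtain ⟨F, hle, hF, hr⟩ := (G.deleteEdges {s(x, z)}).exists_isAcyclic_reachable_eq_le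
  refine ⟨F, hle.trans (deleteEdges_le _), hF, fun h => ?_, ?_⟩
  · have := hle h
    simp at this
  · rw [hr]
    funext a b
    refine propext ⟨fun h => h.mono (deleteEdges_le _), ?_⟩
    rintro ⟨p⟩
    induction p with
    | nil => exact Reachable.refl _
    | @cons u v w h p ih =>
      refine Reachable.trans ?_ ih
      by_cases he : s(u, v) = s(x, z)
      · rcases Sym2.eq_iff.1 he with ⟨rfl, rfl⟩ | ⟨rfl, rfl⟩
        · exact hxz
        · exact hxz.symm
      · exact Adj.reachable (by simp [deleteEdges_adj, h, he])

lemma le_genIndepNum {V : Type*} [Fintype V] (G : SimpleGraph V) (S : Finset V)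
    (hS : G.IsGenIndepSet 4 S) : S.card ≤ G.genIndepNum 4 := by
  refine le_csSup ⟨Fintype.card V, ?_⟩ ⟨S, hS, rfl⟩
  rintro n ⟨T, -, rfl⟩
  exact T.card_le_univ

end GoodAux

/-- If `G` attains `α₄(G) = (3/4)(n - ω(G))`, then no vertex lying on a cycle of `G` is
adjacent to a pendant vertex of `G`. -/
theorem good_no_cycleVertex_adj_pendant {V : Type*} [Fintype V] (G : SimpleGraph V)
    (hgood : (G.genIndepNum 4 : ℚ) = 3 / 4 * ((Nat.card V : ℚ) - (G.cycleDim : ℚ))) :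
    ∀ x : V, (∃ c : G.Walk x x, c.IsCycle) →
      ∀ y : V, G.Adj x y → Nat.card (G.neighborSet y) ≠ 1 := by
  classical
  rintro x ⟨c, hc⟩ y hxy hy
  have hynbr : ∀ w, G.Adj y w → w = x := by
    intro w hw
    have := (Nat.card_eq_one_iff_unique.1 hy).1
    exact congrArg Subtype.val
      (Subsingleton.elim (⟨w, hw⟩ : G.neighborSet y) ⟨x, hxy.symm⟩)
  obtain ⟨z, hz⟩ : ∃ z, s(x, z) ∈ c.edges := by
    cases c with
    | nil => exact absurd rfl hc.ne_nil
    | @cons _ w _ h p => exact ⟨w, by simp⟩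
  obtain ⟨hadj, hreach⟩ :=
    SimpleGraph.adj_and_reachable_delete_edges_iff_exists_cycle.2 ⟨x, c, hc, hz⟩
  obtain ⟨F, hFG, hF, hFxz, hFr⟩ := GoodAux.exists_forest G hreach
  have hcomp : Nat.card F.ConnectedComponent = Nat.card G.ConnectedComponent := by
    unfold SimpleGraph.ConnectedComponent
    rw [hFr]
  have hcount := GoodAux.card_le_edges_add_comps F
  -- choose an endpoint of every edge
  have hend : ∀ e : Sym2 V, ∃ v ∈ e, e = s(x, z) → v = x := by
    intro e
    by_cases he : e = s(x, z)
    · exact ⟨x, by simp [he], fun _ => rfl⟩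
    · induction e with
      | _ a b => exact ⟨a, by simp, fun h => absurd h he⟩
  choose r hr1 hr2 using hend
  let D : Finset (Sym2 V) := G.edgeFinset \ F.edgeFinset
  let X : Finset V := D.image r
  have hsub : F.edgeFinset ⊆ G.edgeFinset := SimpleGraph.edgeFinset_mono hFG
  have hD : D.card + F.edgeFinset.card = G.edgeFinset.card :=
    Finset.card_sdiff_add_card_eq_card hsub
  have hX : X.card ≤ D.card := Finset.card_image_le
  have hxX : x ∈ X := by
    refine Finset.mem_image.2 ⟨s(x, z), ?_, hr2 _ rfl⟩
    simp [D, hadj, hFxz]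
  let U : Finset V := Finset.univ \ insert y X
  have hUc : Fintype.card V ≤ U.card + (X.card + 1) := by
    have h1 := Finset.card_sdiff_add_card_eq_card (Finset.subset_univ (insert y X))
    have h2 := Finset.card_insert_le y X
    rw [Finset.card_univ] at h1
    simp only [U]
    omega
  have hUF : ∀ a ∈ U, ∀ b ∈ U, G.Adj a b → F.Adj a b := by
    intro a ha b hb hab
    by_contra hn
    have hmem : s(a, b) ∈ D := by simp [D, hab, hn]
    have hrX : r s(a, b) ∈ X := Finset.mem_image_of_mem r hmem
    simp only [U, Finset.mem_sdiff, Finset.mem_insert, not_or] at ha hb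
    rcases Sym2.mem_iff.1 (hr1 s(a, b)) with h | h
    · exact ha.2.2 (h ▸ hrX)
    · exact hb.2.2 (h ▸ hrX)
  obtain ⟨S, hSU, hS, hSc⟩ := GoodAux.forest_bound hF _ U rfl
  have hyS : y ∉ S := fun h => by simpa [U] using hSU h
  have hxS : x ∉ S := fun h => by
    have := hSU h
    simp [U, hxX] at this
  have hind : G.IsGenIndepSet 4 (insert y S) := by
    intro T hT hTc
    by_cases hyT : y ∈ T
    · have : (T : Set V) ⊆ {y} := by
        refine GoodAux.subset_of_closed hTc {y} hyT rfl ?_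
        rintro u - rfl w hw huw
        have hwx := hynbr w huw
        subst hwx
        rcases Finset.mem_insert.1 (hT hw) with h | h
        · exact h
        · exact absurd h hxS
      have h1 : T ⊆ {y} := by
        intro a ha
        simpa using this ha
      have := Finset.card_le_card h1
      rw [Finset.card_singleton] at this
      omega
    · have hTS : T ⊆ S := (Finset.subset_insert_iff_of_notMem hyT).1 hT
      refine hS T hTS (hTc.mono ?_)
      intro a b hab
      exact hUF _ (hSU (hTS a.2)) _ (hSU (hTS b.2)) hab
  have hlow := GoodAux.le_genIndepNum G _ hind
  rw [Finset.card_insert_of_notMem hyS] at hlow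
  have hGe : Nat.card G.edgeSet = G.edgeFinset.card := by
    rw [Nat.card_eq_fintype_card, SimpleGraph.edgeFinset_card]
  have hFe : Nat.card F.edgeSet = F.edgeFinset.card := by
    rw [Nat.card_eq_fintype_card, SimpleGraph.edgeFinset_card]
  rw [hFe, hcomp] at hcount
  have hV : Nat.card V = Fintype.card V := Nat.card_eq_fintype_card
  have hgoodZ : 4 * (G.genIndepNum 4 : ℤ) = 3 * ((Nat.card V : ℤ) - G.cycleDim) := by
    have : 4 * (G.genIndepNum 4 : ℚ) = 3 * ((Nat.card V : ℚ) - (G.cycleDim : ℚ)) := by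
      rw [hgood]; ring
    exact_mod_cast this
  unfold SimpleGraph.cycleDim at hgoodZ
  rw [hGe] at hgoodZ
  omega
end

section
/- Suppose G is a graph with n vertices satisfying α_4(G) = (3/4)(n − ω(G)). Then any two cycles of G are vertex-disjoint. -/
namespace GoodCycles

open SimpleGraph

variable {V : Type*}

lemma reach_delete {G : SimpleGraph V} {a b x y : V} (h : G.Reachable x y) :
    (G.deleteEdges {s(a, b)}).Reachable x y ∨
    ((G.deleteEdges {s(a, b)}).Reachable x a ∧ (G.deleteEdges {s(a, b)}).Reachable b y) ∨
    ((G.deleteEdges {s(a, b)}).Reachable x b ∧ (G.deleteEdges {s(a, b)}).Reachable a y) := by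
  obtain ⟨p⟩ := h
  induction p with
  | nil => exact Or.inl (Reachable.refl _)
  | @cons u v w hadj p ih =>
    by_cases he : s(u, v) = s(a, b)
    · rw [Sym2.eq_iff] at he
      rcases he with ⟨rfl, rfl⟩ | ⟨rfl, rfl⟩
      · rcases ih with ih | ih | ih
        · exact Or.inr (Or.inl ⟨Reachable.refl _, ih⟩)
        · exact Or.inr (Or.inl ⟨Reachable.refl _, ih.2⟩)
        · exact Or.inl ih.2
      · rcases ih with ih | ih | ih
        · exact Or.inr (Or.inr ⟨Reachable.refl _, ih⟩)
        · exact Or.inl ih.2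
        · exact Or.inr (Or.inr ⟨Reachable.refl _, ih.2⟩)
    · have h1 : (G.deleteEdges {s(a, b)}).Reachable u v := by
        apply Adj.reachable
        rw [deleteEdges_adj]
        exact ⟨hadj, he⟩
      rcases ih with ih | ih | ih
      · exact Or.inl (h1.trans ih)
      · exact Or.inr (Or.inl ⟨h1.trans ih.1, ih.2⟩)
      · exact Or.inr (Or.inr ⟨h1.trans ih.1, ih.2⟩)

lemma card_edges_delete [Finite V] {G : SimpleGraph V} {a b : V} (h : G.Adj a b) :
    Nat.card (G.deleteEdges {s(a, b)}).edgeSet + 1 = Nat.card G.edgeSet := by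
  rw [edgeSet_deleteEdges, Nat.card_coe_set_eq, Nat.card_coe_set_eq]
  exact Set.ncard_sdiff_singleton_add_one h (Set.toFinite _)

lemma card_comp_delete [Finite V] {G : SimpleGraph V} {a b : V} :
    Nat.card (G.deleteEdges {s(a, b)}).ConnectedComponent ≤ Nat.card G.ConnectedComponent + 1 := by
  classical
  rw [← Finite.card_option]
  let H := G.deleteEdges {s(a, b)}
  have hle : H ≤ G := G.deleteEdges_le _
  apply Nat.card_le_card_of_injective (fun C : H.ConnectedComponent =>
    if C = H.connectedComponentMk a then none else some (C.map (Hom.ofLE hle)))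
  intro C D
  induction C using ConnectedComponent.ind with | _ x
  induction D using ConnectedComponent.ind with | _ y
  intro h
  by_cases hx : H.Reachable x a <;> by_cases hy : H.Reachable y a
  · exact ConnectedComponent.eq.2 (hx.trans hy.symm)
  · simp [ConnectedComponent.eq, hx, hy] at h
  · simp [ConnectedComponent.eq, hx, hy] at h
  · simp [ConnectedComponent.eq, hx, hy] at h
    rcases reach_delete (a := a) (b := b) h with h | h | h
    · exact ConnectedComponent.eq.2 h
    · exact absurd h.1 hx
    · exact absurd h.2.symm hy

lemma card_comp_delete_eq [Finite V] {G : SimpleGraph V} {a b : V}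
    (h : (G.deleteEdges {s(a, b)}).Reachable a b) :
    Nat.card (G.deleteEdges {s(a, b)}).ConnectedComponent ≤ Nat.card G.ConnectedComponent := by
  let H := G.deleteEdges {s(a, b)}
  have hle : H ≤ G := G.deleteEdges_le _
  apply Nat.card_le_card_of_injective (fun C : H.ConnectedComponent =>
    (C.map (Hom.ofLE hle)))
  intro C D
  induction C using ConnectedComponent.ind with | _ x
  induction D using ConnectedComponent.ind with | _ y
  intro h'
  simp [ConnectedComponent.eq] at h'
  rcases reach_delete (a := a) (b := b) h' with h' | h' | h'
  · exact ConnectedComponent.eq.2 h'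
  · exact ConnectedComponent.eq.2 (h'.1.trans (h.trans h'.2))
  · exact ConnectedComponent.eq.2 (h'.1.trans (h.symm.trans h'.2))

lemma cycleDim_delete [Finite V] {G : SimpleGraph V} {a b : V} (hab : G.Adj a b)
    (h : (G.deleteEdges {s(a, b)}).Reachable a b) :
    (G.deleteEdges {s(a, b)}).cycleDim + 1 ≤ G.cycleDim := by
  have h1 := card_edges_delete hab
  have h2 := card_comp_delete_eq h
  unfold SimpleGraph.cycleDim
  omega

lemma cycleDim_nonneg [Finite V] (G : SimpleGraph V) : 0 ≤ G.cycleDim := by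
  induction hn : Nat.card G.edgeSet generalizing G with
  | zero =>
    have hb : G = ⊥ := by
      rw [Nat.card_coe_set_eq, Set.ncard_eq_zero (Set.toFinite _)] at hn
      exact edgeSet_eq_empty.1 hn
    have : Nat.card V ≤ Nat.card G.ConnectedComponent := by
      apply Nat.card_le_card_of_injective (fun v => G.connectedComponentMk v)
      intro x y h
      subst hb
      simpa using h
    unfold SimpleGraph.cycleDim
    omega
  | succ n ih =>
    have : Nonempty G.edgeSet := (Nat.card_pos_iff.1 (by omega)).1
    obtain ⟨⟨e, he⟩⟩ := this
    induction e with | _ a b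
    have hab : G.Adj a b := he
    have h1 := card_edges_delete hab
    have h2 := card_comp_delete (G := G) (a := a) (b := b)
    have h3 := ih (G.deleteEdges {s(a, b)}) (by omega)
    unfold SimpleGraph.cycleDim at *
    omega

/-- A connected set does not cross a cut without edges. -/
lemma subset_of_no_cross [DecidableEq V] {G : SimpleGraph V} {T B : Finset V}
    (hT : (G.induce (T : Set V)).Connected)
    (hB : ∀ x ∈ T, ∀ y ∈ T, x ∈ B → y ∉ B → ¬ G.Adj x y) :
    T ⊆ B ∨ Disjoint T B := by
  by_contra hcon
  push Not at hcon
  obtain ⟨h1, h2⟩ := hcon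
  obtain ⟨y, hyT, hyB⟩ := Finset.not_subset.1 h1
  obtain ⟨x, hxT, hxB⟩ := Finset.not_disjoint_iff.1 h2
  obtain ⟨p⟩ := hT.preconnected ⟨x, hxT⟩ ⟨y, hyT⟩
  obtain ⟨d, -, hd1, hd2⟩ := p.exists_boundary_dart {z | z.1 ∈ B} hxB hyB
  exact hB _ d.fst.2 _ d.snd.2 hd1 hd2 d.adj

lemma unique_nbr {G : SimpleGraph V} (hG : G.IsAcyclic) {K : Finset V} {v u u' : V}
    (hK : (G.induce (K : Set V)).Connected) (hv : v ∉ K) (hu : u ∈ K) (hu' : u' ∈ K)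
    (h : G.Adj v u) (h' : G.Adj v u') : u = u' := by
  by_contra hne
  have hb := isAcyclic_iff_forall_adj_isBridge.1 hG h
  rw [isBridge_iff] at hb
  apply hb
  have h1 : (G.deleteEdges {s(v, u)}).Adj v u' := by
    rw [deleteEdges_adj]
    refine ⟨h', ?_⟩
    simp only [Set.mem_singleton_iff, Sym2.eq_iff]
    rintro (⟨-, h⟩ | ⟨h, -⟩)
    · exact hne h.symm
    · exact hv (h ▸ hu)
  let f : G.induce (K : Set V) →g G.deleteEdges {s(v, u)} :=
    ⟨fun x => x.1, by
      intro x y hxy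
      rw [deleteEdges_adj]
      refine ⟨hxy, ?_⟩
      simp only [Set.mem_singleton_iff, Sym2.eq_iff]
      rintro (⟨h, -⟩ | ⟨-, h⟩)
      · exact hv (h ▸ x.2)
      · exact hv (h ▸ y.2)⟩
  exact h1.reachable.trans ((hK.preconnected ⟨u', hu'⟩ ⟨u, hu⟩).map f)

/-- Existence of a removable branch in a forest. -/
lemma exists_branch [DecidableEq V] {G : SimpleGraph V} (hG : G.IsAcyclic) (n : ℕ) :
    ∀ (Y B : Finset V) (v : V), B.card = n → v ∈ Y → v ∉ B → B ⊆ Y → 3 ≤ B.card →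
      (∀ x ∈ B, ∀ y ∈ Y, y ∉ B → y ≠ v → ¬ G.Adj x y) →
      ∃ (B' : Finset V) (v' : V), v' ∈ Y ∧ v' ∉ B' ∧ B' ⊆ Y ∧ 3 ≤ B'.card ∧
      (∀ x ∈ B', ∀ y ∈ Y, y ∉ B' → y ≠ v' → ¬ G.Adj x y) ∧ G.IsGenIndepSet 4 B' := by
  induction n using Nat.strong_induction_on with
  | _ n ih =>
  intro Y B v hn hvY hvB hBY hB3 hcut
  by_cases hind : G.IsGenIndepSet 4 B
  · exact ⟨B, v, hvY, hvB, hBY, hB3, hcut, hind⟩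
  unfold SimpleGraph.IsGenIndepSet at hind
  push Not at hind
  obtain ⟨T, hTB, hTc, hT4⟩ := hind
  haveI : DecidablePred fun K : Finset V => T ⊆ K ∧ (G.induce (K : Set V)).Connected :=
    fun _ => Classical.propDecidable _
  obtain ⟨K, hKm, hKmax⟩ := Finset.exists_max_image
    (B.powerset.filter (fun K => T ⊆ K ∧ (G.induce (K : Set V)).Connected)) Finset.card
    ⟨T, by simp [hTB, hTc]⟩
  simp only [Finset.mem_filter, Finset.mem_powerset] at hKm hKmax
  obtain ⟨hKB, hTK, hKc⟩ := hKm
  have hK4 : 4 ≤ K.card := hT4.trans (Finset.card_le_card hTK)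
  have hKcl : ∀ x ∈ K, ∀ y ∈ B, y ∉ K → ¬ G.Adj x y := by
    intro x hx y hy hyK hxy
    have hc : (G.induce ((insert y K : Finset V) : Set V)).Connected := by
      have h1 : (G.induce {x, y}).Connected := induce_pair_connected_of_adj hxy
      have h2 := induce_union_connected hKc.preconnected h1.preconnected ⟨x, hx, by simp⟩
      have : ((insert y K : Finset V) : Set V) = (K : Set V) ∪ {x, y} := by
        ext z; simp; grind
      rw [this]
      exact h2
    have := hKmax (insert y K) ⟨by grind, by grind, hc⟩
    rw [Finset.card_insert_of_notMem hyK] at this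
    omega
  have hvK : v ∉ K := fun h => hvB (hKB h)
  have main : ∃ u ∈ K, ∀ x ∈ K, G.Adj x v → x = u := by
    by_cases hex : ∃ u ∈ K, G.Adj u v
    · obtain ⟨u, hu, huv⟩ := hex
      exact ⟨u, hu, fun x hx hxv => unique_nbr hG hKc hvK hx hu hxv.symm huv.symm⟩
    · obtain ⟨u, hu⟩ := Finset.card_pos.1 (show 0 < K.card by omega)
      exact ⟨u, hu, fun x hx hxv => absurd ⟨x, hx, hxv⟩ hex⟩
  obtain ⟨u, hu, huu⟩ := main
  have hcard := Finset.card_erase_of_mem hu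
  have hKle := Finset.card_le_card hKB
  refine ih (K.erase u).card (by omega) Y (K.erase u) u rfl (hBY (hKB hu)) (by simp) ?_
    (by omega) ?_
  · exact (Finset.erase_subset _ _).trans (hKB.trans hBY)
  · intro x hx y hy hyK hyu hxy
    rw [Finset.mem_erase] at hx
    have hyK' : y ∉ K := fun h => hyK (Finset.mem_erase.2 ⟨hyu, h⟩)
    by_cases hyv : y = v
    · subst hyv
      exact hx.1 (huu x hx.2 hxy)
    by_cases hyB : y ∈ B
    · exact hKcl x hx.2 y hyB hyK' hxy
    · exact hcut x (hKB hx.2) y hy hyB hyv hxy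

lemma forest_bound [DecidableEq V] {G : SimpleGraph V} (hG : G.IsAcyclic) (n : ℕ) :
    ∀ Y : Finset V, Y.card = n → ∃ S ⊆ Y, G.IsGenIndepSet 4 S ∧ 3 * Y.card ≤ 4 * S.card := by
  induction n using Nat.strong_induction_on with
  | _ n ih =>
  intro Y hn
  by_cases h4 : Y.card < 4
  · exact ⟨Y, subset_rfl, fun T hT _ => (Finset.card_le_card hT).trans_lt h4, by omega⟩
  obtain ⟨v, hv⟩ := Finset.card_pos.1 (show 0 < Y.card by omega)
  have hc := Finset.card_erase_of_mem hv
  obtain ⟨B, w, hwY, hwB, hBY, hB3, hcut, hBi⟩ := exists_branch hG _ Y (Y.erase v) v rfl hv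
    (by simp) (Finset.erase_subset _ _) (by omega) (by
      intro x hx y hy hy1 hy2
      exact absurd (Finset.mem_erase.2 ⟨hy2, hy⟩) hy1)
  have hsub : insert w B ⊆ Y := by grind
  have hcd := Finset.card_sdiff_add_card_eq_card hsub
  rw [Finset.card_insert_of_notMem hwB] at hcd
  obtain ⟨S, hS, hSi, hSc⟩ := ih (Y \ insert w B).card (by omega) (Y \ insert w B) rfl
  have hdis : Disjoint S B := by
    rw [Finset.disjoint_left]
    intro x hx hxB
    have := hS hx
    grind
  refine ⟨S ∪ B, by grind, ?_, ?_⟩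
  · intro T hT hTc
    rcases subset_of_no_cross (B := B) hTc (by
      intro x hx y hy hxB hyB
      have hyS : y ∈ S := by grind
      have := hS hyS
      exact hcut x hxB y (by grind) hyB (by grind)) with h | h
    · exact hBi T h hTc
    · refine hSi T ?_ hTc
      intro x hx
      have := Finset.disjoint_left.1 h hx
      grind
  · rw [Finset.card_union_of_disjoint hdis]
    omega

lemma indep_of_delete {G : SimpleGraph V} {S : Finset V} {v b : V} (hv : v ∉ S)
    (h : (G.deleteEdges {s(v, b)}).IsGenIndepSet 4 S) : G.IsGenIndepSet 4 S := by
  intro T hT hTc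
  apply h T hT
  refine hTc.mono ?_
  intro x y hxy
  have hxy' : G.Adj x.1 y.1 := hxy
  change (G.deleteEdges {s(v, b)}).Adj x.1 y.1
  rw [deleteEdges_adj]
  refine ⟨hxy', ?_⟩
  simp only [Set.mem_singleton_iff, Sym2.eq_iff]
  rintro (⟨h, -⟩ | ⟨-, h⟩)
  · exact hv (h ▸ hT x.2)
  · exact hv (h ▸ hT y.2)

lemma general_bound [Finite V] [DecidableEq V] (n : ℕ) : ∀ (G : SimpleGraph V) (Y : Finset V),
    Nat.card G.edgeSet = n →
    ∃ S ⊆ Y, G.IsGenIndepSet 4 S ∧ 3 * ((Y.card : ℤ) - G.cycleDim) ≤ 4 * S.card := by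
  induction n with
  | zero =>
    intro G Y hn
    have hb : G = ⊥ := by
      rw [Nat.card_coe_set_eq, Set.ncard_eq_zero (Set.toFinite _)] at hn
      exact edgeSet_eq_empty.1 hn
    obtain ⟨S, h1, h2, h3⟩ := forest_bound (G := G) (hb ▸ isAcyclic_bot) _ Y rfl
    have := cycleDim_nonneg G
    exact ⟨S, h1, h2, by omega⟩
  | succ n ih =>
    intro G Y hn
    by_cases hG : G.IsAcyclic
    · obtain ⟨S, h1, h2, h3⟩ := forest_bound hG _ Y rfl
      have := cycleDim_nonneg G
      exact ⟨S, h1, h2, by omega⟩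
    rw [isAcyclic_iff_forall_adj_isBridge] at hG
    push Not at hG
    obtain ⟨a, b, hab, hnb⟩ := hG
    rw [isBridge_iff, not_not] at hnb
    have h1 := card_edges_delete hab
    have h2 := cycleDim_delete hab hnb
    obtain ⟨S, hS, hSi, hSc⟩ := ih (G.deleteEdges {s(a, b)}) (Y.erase a) (by omega)
    have h3 := Finset.pred_card_le_card_erase (a := a) (s := Y)
    refine ⟨S, hS.trans (Finset.erase_subset _ _), indep_of_delete ?_ hSi, by omega⟩
    intro h
    simpa using hS h

lemma le_genIndepNum [Fintype V] {G : SimpleGraph V} {S : Finset V} (h : G.IsGenIndepSet 4 S) :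
    S.card ≤ G.genIndepNum 4 := by
  apply le_csSup
  · refine ⟨Fintype.card V, ?_⟩
    rintro n ⟨S, -, rfl⟩
    exact Finset.card_le_univ S
  · exact ⟨S, h, rfl⟩

lemma exists_edge_of_mem {G : SimpleGraph V} {u : V} {c : G.Walk u u} (hc : c.IsCycle) {w : V}
    (hw : w ∈ c.support) : ∃ x, s(w, x) ∈ c.edges := by
  obtain ⟨e, he, hwe⟩ := (Walk.mem_support_iff_exists_mem_edges_of_not_nil hc.not_nil).1 hw
  obtain ⟨x, rfl⟩ := hwe
  exact ⟨x, he⟩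

lemma reachable_of_cycle {G : SimpleGraph V} {u a b : V} {c : G.Walk u u} (hc : c.IsCycle)
    (h : s(a, b) ∈ c.edges) : (G.deleteEdges {s(a, b)}).Reachable a b :=
  (adj_and_reachable_delete_edges_iff_exists_cycle.2 ⟨u, c, hc, h⟩).2

/-- Key step: in a good graph, at a common vertex each edge of one cycle is an edge of the other. -/
lemma key [Fintype V] {G : SimpleGraph V}
    (hgood : (G.genIndepNum 4 : ℚ) = 3 / 4 * ((Nat.card V : ℚ) - (G.cycleDim : ℚ)))
    {u v : V} {c : G.Walk u u} {d : G.Walk v v} (hc : c.IsCycle) (hd : d.IsCycle)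
    {w x : V} (hw : w ∈ d.support) (hx : s(w, x) ∈ c.edges) : s(w, x) ∈ d.edges := by
  classical
  by_contra hxd
  have hadj : G.Adj w x := c.adj_of_mem_edges hx
  have h1 := cycleDim_delete hadj (reachable_of_cycle hc hx)
  have hd' := Walk.IsCycle.toDeleteEdges (G := G) {s(w, x)} hd (by
    intro e he h
    rw [Set.mem_singleton_iff] at h
    exact hxd (h ▸ he))
  obtain ⟨y, hy⟩ := exists_edge_of_mem hd' (w := w) (by simpa using hw)
  have hadj' := Walk.adj_of_mem_edges _ hy
  have h2 := cycleDim_delete hadj' (reachable_of_cycle hd' hy)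
  obtain ⟨S, hS, hSi, hSc⟩ := general_bound _
    ((G.deleteEdges {s(w, x)}).deleteEdges {s(w, y)}) (Finset.univ.erase w) rfl
  have hwS : w ∉ S := fun h => by simpa using hS h
  have hfin := le_genIndepNum (indep_of_delete hwS (indep_of_delete hwS hSi))
  have hcard : (Finset.univ.erase w).card + 1 = Nat.card V := by
    rw [Finset.card_erase_add_one (Finset.mem_univ w), Nat.card_eq_fintype_card, Finset.card_univ]
  have hg : 4 * (G.genIndepNum 4 : ℤ) = 3 * ((Nat.card V : ℤ) - G.cycleDim) := by
    have : 4 * (G.genIndepNum 4 : ℚ) = 3 * ((Nat.card V : ℚ) - (G.cycleDim : ℚ)) := by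
      rw [hgood]; ring
    exact_mod_cast this
  omega

lemma support_sub {G : SimpleGraph V} {u v : V} {c : G.Walk u u} {d : G.Walk v v}
    (h : ∀ w x, w ∈ d.support → s(w, x) ∈ c.edges → s(w, x) ∈ d.edges)
    {a b : V} (p : G.Walk a b) (hp : ∀ e ∈ p.edges, e ∈ c.edges) (ha : a ∈ d.support) :
    ∀ z ∈ p.support, z ∈ d.support := by
  induction p with
  | nil => intro z hz; simp at hz; exact hz ▸ ha
  | @cons a m b hadj p ih =>
    have h1 := h a m ha (hp _ (by simp))
    intro z hz
    rw [Walk.support_cons, List.mem_cons] at hz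
    rcases hz with rfl | hz
    · exact ha
    · exact ih (fun e he => hp e (by simp [he])) (d.snd_mem_support_of_mem_edges h1) z hz

lemma cycle_sub [Fintype V] {G : SimpleGraph V}
    (hgood : (G.genIndepNum 4 : ℚ) = 3 / 4 * ((Nat.card V : ℚ) - (G.cycleDim : ℚ)))
    {u v : V} {c : G.Walk u u} {d : G.Walk v v} (hc : c.IsCycle) (hd : d.IsCycle)
    (hw : ∃ w, w ∈ c.support ∧ w ∈ d.support) :
    (∀ z ∈ c.support, z ∈ d.support) ∧ (∀ e ∈ c.edges, e ∈ d.edges) := by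
  classical
  obtain ⟨w, hwc, hwd⟩ := hw
  have hk : ∀ w x, w ∈ d.support → s(w, x) ∈ c.edges → s(w, x) ∈ d.edges :=
    fun w x h1 h2 => key hgood hc hd h1 h2
  have h1 : ∀ z ∈ c.support, z ∈ d.support := by
    intro z hz
    refine support_sub hk (c.rotate w hwc) ?_ hwd z ?_
    · intro e he
      exact (c.rotate_edges w hwc).mem_iff.1 he
    · exact (Walk.mem_support_rotate_iff c w hwc).2 hz
  refine ⟨h1, ?_⟩
  intro e he
  induction e with | _ a b
  exact hk a b (h1 a (c.fst_mem_support_of_mem_edges he)) he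

end GoodCycles

/-- If `G` attains `α₄(G) = (3/4)(n - ω(G))`, then any two cycles of `G` are vertex-disjoint:
two cycles sharing a vertex coincide (same vertex set and same edge set). -/
theorem good_cycles_disjoint {V : Type*} [Fintype V] (G : SimpleGraph V)
    (hgood : (G.genIndepNum 4 : ℚ) = 3 / 4 * ((Nat.card V : ℚ) - (G.cycleDim : ℚ))) :
    ∀ (u v : V) (c : G.Walk u u) (d : G.Walk v v), c.IsCycle → d.IsCycle →
      (∃ w, w ∈ c.support ∧ w ∈ d.support) →
      {w | w ∈ c.support} = {w | w ∈ d.support} ∧ {e | e ∈ c.edges} = {e | e ∈ d.edges} := by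
  intro u v c d hc hd hw
  have h1 := GoodCycles.cycle_sub hgood hc hd hw
  have h2 := GoodCycles.cycle_sub hgood hd hc (by
    obtain ⟨w, h, h'⟩ := hw
    exact ⟨w, h', h⟩)
  exact ⟨Set.ext fun z => ⟨h1.1 z, h2.1 z⟩, Set.ext fun e => ⟨h1.2 e, h2.2 e⟩⟩
end

section
/- Suppose G is a graph with n vertices satisfying α_4(G) = (3/4)(n − ω(G)). Then the length of every cycle of G is congruent to 1 modulo 4. -/
namespace GoodCycle

open Finset

open scoped Classical in
/-- Number of ordered adjacent pairs between `A` and `B`. -/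
noncomputable def ee {V : Type*} (G : SimpleGraph V) (A B : Finset V) : ℕ :=
  ∑ x ∈ A, ∑ y ∈ B, if G.Adj x y then 1 else 0

/-- `A` is a union of components of `G[S]`. -/
def Cl {V : Type*} (G : SimpleGraph V) (S A : Finset V) : Prop :=
  A ⊆ S ∧ ∀ x ∈ A, ∀ y ∈ S, G.Adj x y → y ∈ A

/-- Cut version of connectedness of `G[S]`. -/
def Cn {V : Type*} (G : SimpleGraph V) (S : Finset V) : Prop :=
  S.Nonempty ∧ ∀ A, Cl G S A → A.Nonempty → A = S

def GI {V : Type*} (G : SimpleGraph V) (S : Finset V) : Prop :=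
  ∀ T, T ⊆ S → Cn G T → T.card < 4

section
variable {V : Type*} {G : SimpleGraph V}

open scoped Classical in
lemma ee_comm (A B : Finset V) : ee G A B = ee G B A := by
  unfold ee
  rw [sum_comm]
  exact sum_congr rfl fun x _ => sum_congr rfl fun y _ => if_congr (G.adj_comm y x) rfl rfl

open scoped Classical in
lemma ee_union_left {A B : Finset V} (h : Disjoint A B) (C : Finset V) :
    ee G (A ∪ B) C = ee G A C + ee G B C := by
  unfold ee
  rw [sum_union h]

open scoped Classical in
lemma ee_union_right {A B : Finset V} (h : Disjoint A B) (C : Finset V) :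
    ee G C (A ∪ B) = ee G C A + ee G C B := by
  rw [ee_comm, ee_union_left h, ee_comm A, ee_comm B]

open scoped Classical in
lemma ee_singleton (r : V) (B : Finset V) :
    ee G {r} B = (B.filter (fun y => G.Adj r y)).card := by
  unfold ee
  simp

lemma ee_zero {A B : Finset V} (h : ∀ x ∈ A, ∀ y ∈ B, ¬ G.Adj x y) : ee G A B = 0 := by
  unfold ee
  refine sum_eq_zero fun x hx => sum_eq_zero fun y hy => ?_
  rw [if_neg (h x hx y hy)]

open scoped Classical in
lemma Cl.compl {S A : Finset V} (h : Cl G S A) : Cl G S (S \ A) := by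
  refine ⟨sdiff_subset, fun x hx y hy hxy => ?_⟩
  rw [mem_sdiff] at hx ⊢
  exact ⟨hy, fun hyA => hx.2 (h.2 y hyA x hx.1 hxy.symm)⟩

open scoped Classical in
lemma Cl.inter {S A T : Finset V} (h : Cl G S A) (hT : T ⊆ S) : Cl G T (A ∩ T) := by
  refine ⟨inter_subset_right, fun x hx y hy hxy => ?_⟩
  rw [mem_inter] at hx ⊢
  exact ⟨h.2 x hx.1 y (hT hy) hxy, hy⟩

lemma Cl.trans {S A B : Finset V} (h : Cl G S A) (h' : Cl G A B) : Cl G S B :=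
  ⟨h'.1.trans h.1, fun x hx y hy hxy => h'.2 x hx y (h.2 x (h'.1 hx) y hy hxy) hxy⟩

lemma Cl.cn_subset {S A T : Finset V} (h : Cl G S A) (hT : T ⊆ S) (hc : Cn G T)
    {x : V} (hx : x ∈ T) (hxA : x ∈ A) : T ⊆ A := by
  classical
  have := hc.2 _ (h.inter hT) ⟨x, mem_inter.2 ⟨hxA, hx⟩⟩
  rw [← this]
  exact inter_subset_left

lemma GI.mono {S T : Finset V} (h : GI G S) (hT : T ⊆ S) : GI G T :=
  fun U hU hc => h U (hU.trans hT) hc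

open scoped Classical in
lemma GI.union {A B : Finset V} (hA : GI G A) (hB : GI G B)
    (h : ∀ x ∈ A, ∀ y ∈ B, G.Adj x y → y ∈ A) : GI G (A ∪ B) := by
  intro T hT hc
  have hcl : Cl G (A ∪ B) A := by
    refine ⟨subset_union_left, fun x hx y hy hxy => ?_⟩
    rcases mem_union.1 hy with hy | hy
    · exact hy
    · exact h x hx y hy hxy
  by_cases hx : ∃ x ∈ T, x ∈ A
  · obtain ⟨x, hx, hxA⟩ := hx
    exact hA T (hcl.cn_subset hT hc hx hxA) hc
  · push Not at hx
    exact hB T (fun y hy => (mem_union.1 (hT hy)).resolve_left (hx y hy)) hc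

lemma GI_small {A : Finset V} (h : A.card < 4) : GI G A :=
  fun _ hT _ => (card_le_card hT).trans_lt h

/-- components exist -/
lemma exists_comp {S : Finset V} {x : V} (hx : x ∈ S) :
    ∃ K, Cl G S K ∧ Cn G K ∧ x ∈ K := by
  classical
  let K := S.filter (fun y => ∀ A, Cl G S A → x ∈ A → y ∈ A)
  have hxK : x ∈ K := mem_filter.2 ⟨hx, fun _ _ h => h⟩
  have hK : Cl G S K := by
    refine ⟨filter_subset _ _, fun a ha b hb hab => ?_⟩
    refine mem_filter.2 ⟨hb, fun A hA hxA => hA.2 a ((mem_filter.1 ha).2 A hA hxA) b hb hab⟩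
  refine ⟨K, hK, ⟨⟨x, hxK⟩, fun B hB hne => ?_⟩, hxK⟩
  by_cases hxB : x ∈ B
  · refine subset_antisymm hB.1 fun y hy => ?_
    exact (mem_filter.1 hy).2 B (hK.trans hB) hxB
  · exfalso
    obtain ⟨b, hb⟩ := hne
    have := (mem_filter.1 (hB.1 hb)).2 (K \ B) (hK.trans hB.compl) (mem_sdiff.2 ⟨hxK, hxB⟩)
    exact (mem_sdiff.1 this).2 hb

open scoped Classical in
/-- The splitting lemma. -/
lemma split {S K : Finset V} {r : V} (hS : Cn G S) (hr : r ∈ S) (hK : Cl G (S.erase r) K)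
    (hKc : Cn G K) :
    r ∈ S \ K ∧ K ⊆ S ∧ Cn G (S \ K) ∧ 
    (∀ x ∈ S \ K, ∀ y ∈ K, G.Adj x y → x = r) ∧
    ee G (S \ K) K = (K.filter (fun y => G.Adj r y)).card ∧
    ee G S S = ee G (S \ K) (S \ K) + ee G K K + 2 * (K.filter (fun y => G.Adj r y)).card ∧
    0 < (K.filter (fun y => G.Adj r y)).card := by
  have hKS : K ⊆ S := hK.1.trans (erase_subset _ _)
  have hrK : r ∉ K := fun h => by simpa using hK.1 h
  have hrT : r ∈ S \ K := mem_sdiff.2 ⟨hr, hrK⟩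
  have hadj : ∀ x ∈ S \ K, ∀ y ∈ K, G.Adj x y → x = r := by
    intro x hx y hy hxy
    by_contra hne
    rw [mem_sdiff] at hx
    exact hx.2 (hK.2 y hy x (mem_erase.2 ⟨hne, hx.1⟩) hxy.symm)
  have key : ∀ B, Cl G (S \ K) B → B.Nonempty → r ∈ B := by
    intro B hB hne
    by_contra hrB
    have : Cl G S B := by
      refine ⟨hB.1.trans sdiff_subset, fun x hx y hy hxy => ?_⟩
      by_cases hyK : y ∈ K
      · exact absurd (hadj x (hB.1 hx) y hyK hxy ▸ hx) hrB
      · exact hB.2 x hx y (mem_sdiff.2 ⟨hy, hyK⟩) hxy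
    exact hrB (hS.2 B this hne ▸ hr)
  have hee : ee G (S \ K) K = (K.filter (fun y => G.Adj r y)).card := by
    rw [← ee_singleton]
    have h1 : S \ K = {r} ∪ (S \ K).erase r := by
      ext z; simp only [mem_union, mem_singleton, mem_erase]; grind
    rw [h1, ee_union_left (by simp), ee_zero (A := (S \ K).erase r), add_zero]
    intro x hx y hy hxy
    exact (mem_erase.1 hx).1 (hadj x (mem_erase.1 hx).2 y hy hxy)
  refine ⟨hrT, hKS, ⟨⟨r, hrT⟩, fun B hB hne => ?_⟩, hadj, hee, ?_, ?_⟩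
  · by_contra hBne
    have hne2 : ((S \ K) \ B).Nonempty := by
      rw [sdiff_nonempty]
      exact fun h => hBne (subset_antisymm hB.1 h)
    exact (mem_sdiff.1 (key _ hB.compl hne2)).2 (key B hB hne)
  · have h1 : S = (S \ K) ∪ K := (sdiff_union_of_subset hKS).symm
    have hd : Disjoint (S \ K) K := sdiff_disjoint
    conv_lhs => rw [h1]
    rw [ee_union_left hd, ee_union_right hd, ee_union_right hd, ee_comm K (S \ K), hee]
    ring
  · rw [card_pos]
    by_contra hemp
    rw [not_nonempty_iff_eq_empty, filter_eq_empty_iff] at hemp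
    have : Cl G S K := by
      refine ⟨hKS, fun x hx y hy hxy => ?_⟩
      by_cases hyr : y = r
      · subst hyr; exact absurd hxy.symm (hemp hx)
      · exact hK.2 x hx y (mem_erase.2 ⟨hyr, hy⟩) hxy
    exact hrK (hS.2 K this hKc.1 ▸ hr)

open scoped Classical in
/-- gluing two solutions, with the root deleted -/
lemma glue {S K X1 X2 : Finset V} {r : V}
    (hadj : ∀ x ∈ S \ K, ∀ y ∈ K, G.Adj x y → x = r)
    (h1 : GI G ((S \ K) \ X1)) (h2 : GI G (K \ X2)) (hr : r ∈ X1) :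
    GI G (S \ (X1 ∪ X2)) := by
  refine GI.mono (h1.union h2 ?_) ?_
  · intro x hx y hy hxy
    rw [mem_sdiff] at hx hy
    exact absurd (hadj x hx.1 y hy.1 hxy ▸ hr) hx.2
  · intro x hx
    simp only [mem_sdiff, mem_union] at hx ⊢
    tauto

open scoped Classical in
/-- Rooted main bound. -/
lemma main_bound (n : ℕ) : ∀ (S : Finset V), S.card = n → Cn G S → ∀ r ∈ S,
    ∃ X A, X ⊆ S ∧ A ⊆ S \ X ∧ Cl G (S \ X) A ∧ r ∈ X ∪ A ∧ A.card < 4 ∧ GI G (S \ X) ∧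
      8 * X.card + 2 * A.card + 4 * S.card ≤ 3 * ee G S S + 6 := by
  induction n using Nat.strong_induction_on with
  | _ n ih =>
  intro S hSn hS r hr
  by_cases hSr : S = {r}
  · subst hSr
    refine ⟨∅, {r}, by simp, by simp, ⟨by simp, by simp⟩, by simp, by simp, ?_, by simp⟩
    exact GI_small (by simp)
  obtain ⟨u, hu, hur⟩ : ∃ u ∈ S, u ≠ r := by
    by_contra! h
    exact hSr (eq_singleton_iff_unique_mem.2 ⟨hr, h⟩)
  obtain ⟨K, hK, hKc, huK⟩ := exists_comp (G := G) (S := S.erase r) (x := u)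
    (mem_erase.2 ⟨hur, hu⟩)
  obtain ⟨hrT, hKS, hTc, hadj, -, hD, hd⟩ := split hS hr hK hKc
  set d := (K.filter (fun y => G.Adj r y)).card with hd_def
  obtain ⟨w, hw⟩ := card_pos.1 hd
  have hw' := mem_filter.1 hw
  have hcard : (S \ K).card + K.card = S.card := card_sdiff_add_card_eq_card hKS
  have hTpos : 0 < (S \ K).card := card_pos.2 ⟨r, hrT⟩
  have hKpos : 0 < K.card := card_pos.2 ⟨u, huK⟩
  obtain ⟨X1, A1, hX1, hA1, hcl1, hr1, hs1, hg1, hb1⟩ :=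
    ih _ (by omega) (S \ K) rfl hTc r hrT
  obtain ⟨X2, A2, hX2, hA2, hcl2, hr2, hs2, hg2, hb2⟩ :=
    ih _ (by omega) K rfl hKc w hw'.1
  have hXd : Disjoint X1 X2 := disjoint_of_subset_left hX1
    (disjoint_of_subset_right hX2 sdiff_disjoint)
  have hXc : (X1 ∪ X2).card = X1.card + X2.card := card_union_of_disjoint hXd
  have hXS : X1 ∪ X2 ⊆ S := union_subset (hX1.trans sdiff_subset) (hX2.trans hKS)
  by_cases hrX : r ∈ X1
  · refine ⟨X1 ∪ X2, ∅, hXS, by simp, ⟨by simp, by simp⟩, by simp [hrX], by simp,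
      glue hadj hg1 hg2 hrX, ?_⟩
    rw [hXc]; simp only [card_empty]; omega
  have hrA : r ∈ A1 := (mem_union.1 hr1).resolve_left hrX
  have hA1pos : 0 < A1.card := card_pos.2 ⟨r, hrA⟩
  by_cases hcase : d = 1 ∧ A1.card + A2.card < 4
  · obtain ⟨hd1, hs⟩ := hcase
    have huniq : ∀ y ∈ K, G.Adj r y → y = w := by
      intro y hy hry
      exact card_le_one.1 hd1.le y (mem_filter.2 ⟨hy, hry⟩) w hw
    have hAc : (A1 ∪ A2).card ≤ A1.card + A2.card := card_union_le _ _
    have hAcl : Cl G (S \ (X1 ∪ X2)) (A1 ∪ A2) := by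
      constructor
      · intro x hx
        rcases mem_union.1 hx with hx | hx
        · have h := hA1 hx
          simp only [mem_sdiff, mem_union] at h ⊢
          exact ⟨h.1.1, fun h' => h'.elim h.2 fun h2 => h.1.2 (hX2 h2)⟩
        · have h := hA2 hx
          simp only [mem_sdiff, mem_union] at h ⊢
          exact ⟨hKS h.1, fun h' => h'.elim (fun h1 => (mem_sdiff.1 (hX1 h1)).2 h.1) h.2⟩
      · intro x hx y hy hxy
        simp only [mem_sdiff, mem_union, not_or] at hy
        obtain ⟨hyS, hy1, hy2⟩ := hy
        rw [mem_union] at hx ⊢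
        by_cases hyK : y ∈ K
        · right
          rcases hx with hx | hx
          · have hx1 := (mem_sdiff.1 (hA1 hx)).1
            have hxr := hadj x hx1 y hyK hxy
            have := huniq y hyK (hxr ▸ hxy)
            subst this
            exact (mem_union.1 hr2).resolve_left hy2
          · exact hcl2.2 x hx y (mem_sdiff.2 ⟨hyK, hy2⟩) hxy
        · left
          have hyT : y ∈ S \ K := mem_sdiff.2 ⟨hyS, hyK⟩
          rcases hx with hx | hx
          · exact hcl1.2 x hx y (mem_sdiff.2 ⟨hyT, hy1⟩) hxy
          · have := hadj y hyT x (mem_sdiff.1 (hA2 hx)).1 hxy.symm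
            rw [this]; exact hrA
    refine ⟨X1 ∪ X2, A1 ∪ A2, hXS, hAcl.1, hAcl, by simp [hrA], by omega, ?_, ?_⟩
    · have hg : GI G ((A1 ∪ A2) ∪ ((((S \ K) \ X1) \ A1) ∪ ((K \ X2) \ A2))) := by
        refine GI.union (GI_small (by omega)) (GI.union (hg1.mono sdiff_subset)
          (hg2.mono sdiff_subset) ?_) ?_
        · intro x hx y hy hxy
          rw [mem_sdiff, mem_sdiff] at hx hy
          exact absurd (hadj x hx.1.1 y hy.1.1 hxy ▸ hrA) hx.2
        · intro x hx y hy hxy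
          refine hAcl.2 x hx y ?_ hxy
          rcases mem_union.1 hy with hy | hy
          · have hy := (mem_sdiff.1 hy).1
            rw [mem_sdiff, mem_sdiff] at hy
            refine mem_sdiff.2 ⟨hy.1.1, fun h => ?_⟩
            exact (mem_union.1 h).elim hy.2 fun h => hy.1.2 (hX2 h)
          · have hy := (mem_sdiff.1 hy).1
            rw [mem_sdiff] at hy
            refine mem_sdiff.2 ⟨hKS hy.1, fun h => ?_⟩
            exact (mem_union.1 h).elim (fun h => (mem_sdiff.1 (hX1 h)).2 hy.1) hy.2
      refine hg.mono fun x hx => ?_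
      clear * - hx
      simp only [mem_sdiff, mem_union] at hx ⊢
      tauto
    · rw [hXc]; omega
  · have hX1' : insert r X1 ⊆ S \ K := insert_subset hrT hX1
    have hc : (insert r X1 ∪ X2).card ≤ X1.card + 1 + X2.card :=
      (card_union_le _ _).trans (by have := card_insert_le r X1; omega)
    refine ⟨insert r X1 ∪ X2, ∅, union_subset (hX1'.trans sdiff_subset) (hX2.trans hKS), by simp,
      ⟨by simp, by simp⟩, by simp, by simp, 
      glue hadj (hg1.mono ?_) hg2 (mem_insert_self _ _), ?_⟩
    · exact sdiff_subset_sdiff subset_rfl (subset_insert _ _)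
    · simp only [card_empty]
      omega

open scoped Classical in
/-- Analysis of a tight connected set at a vertex with two neighbours in one piece. -/
lemma tight_split {S K : Finset V} {v : V} (hS : Cn G S) (hv : v ∈ S)
    (hmin : ∀ X ⊆ S, GI G (S \ X) → 3 * ee G S S + 6 ≤ 8 * X.card + 4 * S.card)
    (hK : Cl G (S.erase v) K) (hKc : Cn G K)
    (hd2 : 2 ≤ (K.filter (fun y => G.Adj v y)).card) :
    (K.filter (fun y => G.Adj v y)).card = 2 ∧
    ∃ x : ℕ, 3 * ee G (S \ K) (S \ K) + 4 = 8 * x + 4 * (S \ K).card := by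
  obtain ⟨hrT, hKS, hTc, hadj, -, hD, hd⟩ := split hS hv hK hKc
  set d := (K.filter (fun y => G.Adj v y)).card with hd_def
  obtain ⟨w, hw⟩ := hKc.1
  have hcard : (S \ K).card + K.card = S.card := card_sdiff_add_card_eq_card hKS
  obtain ⟨X1, A1, hX1, hA1, hcl1, hr1, hs1, hg1, hb1⟩ :=
    main_bound _ (S \ K) rfl hTc v hrT
  obtain ⟨X2, A2, hX2, hA2, hcl2, hr2, hs2, hg2, hb2⟩ :=
    main_bound _ K rfl hKc w hw
  have hX1' : insert v X1 ⊆ S \ K := insert_subset hrT hX1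
  have hm := hmin (insert v X1 ∪ X2) (union_subset (hX1'.trans sdiff_subset) (hX2.trans hKS))
    (glue hadj
      (hg1.mono (sdiff_subset_sdiff subset_rfl (subset_insert _ _))) hg2 (mem_insert_self _ _))
  have hc := card_union_le (insert v X1) X2
  by_cases hrX : v ∈ X1
  · rw [insert_eq_of_mem hrX] at hc hm
    omega
  have hrA : v ∈ A1 := (mem_union.1 hr1).resolve_left hrX
  have hA1pos : 0 < A1.card := card_pos.2 ⟨v, hrA⟩
  rw [card_insert_of_notMem hrX] at hc
  exact ⟨by omega, X1.card, by omega⟩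

open scoped Classical in
lemma tight_mod {S C : Finset V} (hS : Cn G S)
    (hmin : ∀ X ⊆ S, GI G (S \ X) → 3 * ee G S S + 6 ≤ 8 * X.card + 4 * S.card)
    (hCS : C ⊆ S) (hCne : C.Nonempty)
    (h2 : ∀ v ∈ C, 2 ≤ (C.filter (fun y => G.Adj v y)).card)
    (hcon : ∀ v ∈ C, ∃ w ∈ C, w ≠ v ∧ ∀ A, Cl G (S.erase v) A → w ∈ A → C.erase v ⊆ A) :
    C.card % 4 = 1 := by
  have hex : ∀ v ∈ C, ∃ K, Cl G (S.erase v) K ∧ Cn G K ∧ C.erase v ⊆ K := by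
    intro v hv
    obtain ⟨w, hw, hwv, h⟩ := hcon v hv
    obtain ⟨K, hK, hKc, hwK⟩ := exists_comp (G := G) (S := S.erase v) (x := w)
      (mem_erase.2 ⟨hwv, hCS hw⟩)
    exact ⟨K, hK, hKc, h K hK hwK⟩
  choose! K hK hKc hCK using hex
  have hsub : ∀ v ∈ C, C.filter (fun y => G.Adj v y) ⊆ (K v).filter (fun y => G.Adj v y) := by
    intro v hv y hy
    rw [mem_filter] at hy ⊢
    exact ⟨hCK v hv (mem_erase.2 ⟨hy.2.ne', hy.1⟩), hy.2⟩
  have htight : ∀ v ∈ C, _ := fun v hv => tight_split hS (hCS hv) hmin (hK v hv) (hKc v hv)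
    ((h2 v hv).trans (card_le_card (hsub v hv)))
  have hsplit : ∀ v ∈ C, _ := fun v hv => split hS (hCS hv) (hK v hv) (hKc v hv)
  have hdisj : ∀ v ∈ C, ∀ w ∈ C, v ≠ w → Disjoint (S \ K v) (S \ K w) := by
    intro v hv w hw hvw
    rw [disjoint_iff_inter_eq_empty]
    by_contra hne
    have hvB : v ∉ (S \ K v) ∩ (S \ K w) := fun h =>
      (mem_sdiff.1 (mem_inter.1 h).2).2 (hCK w hw (mem_erase.2 ⟨hvw, hv⟩))
    have hwB : w ∉ (S \ K v) ∩ (S \ K w) := fun h =>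
      (mem_sdiff.1 (mem_inter.1 h).1).2 (hCK v hv (mem_erase.2 ⟨hvw.symm, hw⟩))
    have hcl : Cl G S ((S \ K v) ∩ (S \ K w)) := by
      refine ⟨inter_subset_left.trans sdiff_subset, fun x hx y hy hxy => ?_⟩
      have hx' := mem_inter.1 hx
      refine mem_inter.2 ⟨mem_sdiff.2 ⟨hy, fun h => ?_⟩, mem_sdiff.2 ⟨hy, fun h => ?_⟩⟩
      · exact hvB ((hsplit v hv).2.2.2.1 x hx'.1 y h hxy ▸ hx)
      · exact hwB ((hsplit w hw).2.2.2.1 x hx'.2 y h hxy ▸ hx)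
    have heq := hS.2 _ hcl (nonempty_iff_ne_empty.2 hne)
    exact hvB (by rw [heq]; exact hCS hv)
  have hcover : C.biUnion (fun v => S \ K v) = S := by
    apply hS.2
    · refine ⟨biUnion_subset.2 fun v _ => sdiff_subset, fun x hx y hy hxy => ?_⟩
      obtain ⟨v, hv, hxv⟩ := mem_biUnion.1 hx
      by_cases hyK : y ∈ K v
      · have hxe := (hsplit v hv).2.2.2.1 x hxv y hyK hxy
        subst hxe
        have heq := eq_of_subset_of_card_le (hsub x hv)
          (by rw [(htight x hv).1]; exact h2 x hv)
        have hyC : y ∈ C := (mem_filter.1 (heq ▸ mem_filter.2 ⟨hyK, hxy⟩ :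
          y ∈ C.filter (fun y => G.Adj x y))).1
        exact mem_biUnion.2 ⟨y, hyC, (hsplit y hyC).1⟩
      · exact mem_biUnion.2 ⟨v, hv, mem_sdiff.2 ⟨hy, hyK⟩⟩
    · obtain ⟨v, hv⟩ := hCne
      exact ⟨v, mem_biUnion.2 ⟨v, hv, (hsplit v hv).1⟩⟩
  have hpd : (C : Set V).PairwiseDisjoint (fun v => S \ K v) := fun v hv w hw h =>
    hdisj v hv w hw h
  have hScard : S.card = ∑ v ∈ C, (S \ K v).card := by
    conv_lhs => rw [← hcover]
    exact card_biUnion hpd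
  have hSee : ee G S S = ∑ v ∈ C, (ee G (S \ K v) (S \ K v) + 2) := by
    have : ee G S S = ∑ v ∈ C, ee G (S \ K v) S := by
      have h1 : ee G S S = ee G (C.biUnion (fun v => S \ K v)) S := by rw [hcover]
      rw [h1]
      unfold ee
      exact sum_biUnion hpd
    rw [this]
    refine sum_congr rfl fun v hv => ?_
    have hs := hsplit v hv
    have h1 : S = (S \ K v) ∪ K v := (sdiff_union_of_subset hs.2.1).symm
    have h2 : ee G (S \ K v) S = ee G (S \ K v) ((S \ K v) ∪ K v) := by rw [← h1]
    rw [h2, ee_union_right sdiff_disjoint, hs.2.2.2.2.1, (htight v hv).1]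
  have hx : ∀ v ∈ C, ∃ x : ℕ, 3 * ee G (S \ K v) (S \ K v) + 4 = 8 * x + 4 * (S \ K v).card :=
    fun v hv => (htight v hv).2
  choose! x hx using hx
  have hsum := sum_congr (s₁ := C) rfl hx
  simp only [sum_add_distrib, ← mul_sum, sum_const, smul_eq_mul] at hsum hSee
  obtain ⟨r, hr⟩ := hS.1
  obtain ⟨X, A, hX, -, -, -, -, hg, hb⟩ := main_bound _ S rfl hS r hr
  have hm := hmin X hX hg
  obtain ⟨v0, hv0⟩ := hCne
  -- parity of the root component of the whole set
  have hA : A.card = 0 := by omega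
  omega

lemma cn_of_connected {T : Finset V} (h : (G.induce (T : Set V)).Connected) : Cn G T := by
  obtain ⟨⟨x, hx⟩⟩ := h.nonempty
  refine ⟨⟨x, hx⟩, fun A hA hne => subset_antisymm hA.1 fun y hy => ?_⟩
  obtain ⟨a, ha⟩ := hne
  have key : ∀ (p q : (T : Set V)), (G.induce (T : Set V)).Walk p q → p.1 ∈ A → q.1 ∈ A := by
    intro p q w
    induction w with
    | nil => exact id
    | cons h _ ih => exact fun hp => ih (hA.2 _ hp _ (by simp) h)
  obtain ⟨w⟩ := h.preconnected ⟨a, hA.1 ha⟩ ⟨y, hy⟩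
  exact key _ _ w ha

lemma walk_closed {S A : Finset V} (hA : Cl G S A) {u v : V} (p : G.Walk u v)
    (hp : ∀ x ∈ p.support, x ∈ S) (hu : u ∈ A) : v ∈ A := by
  induction p with
  | nil => exact hu
  | cons h p ih =>
    refine ih (fun x hx => hp x (by simp [hx])) (hA.2 _ hu _ (hp _ (by simp)) h)

end
end GoodCycle

namespace GoodCycle
open Finset

open scoped Classical in
lemma cycle_facts {V : Type*} {G : SimpleGraph V} {u : V} (c : G.Walk u u) (hc : c.IsCycle)
    (S : Finset V) (hS : c.support.toFinset ⊆ S) (v : V) (hv : v ∈ c.support.toFinset) :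
    2 ≤ (c.support.toFinset.filter (fun y => G.Adj v y)).card ∧
    ∃ w ∈ c.support.toFinset, w ≠ v ∧
      ∀ A, Cl G (S.erase v) A → w ∈ A → c.support.toFinset.erase v ⊆ A := by
  have hv' : v ∈ c.support := List.mem_toFinset.1 hv
  have hsup : ∀ x, x ∈ (c.rotate v hv').support ↔ x ∈ c.support := by
    intro x; exact SimpleGraph.Walk.mem_support_rotate_iff c v hv'
  have hd : (c.rotate v hv').IsCycle := hc.rotate hv'
  generalize c.rotate v hv' = d at hsup hd
  have hsnd := hd.snd_ne_penultimate
  have hnn : ¬ d.Nil := hd.not_nil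
  have ha1 : G.Adj v d.snd := d.adj_snd hnn
  have ha2 : G.Adj d.penultimate v := d.adj_penultimate hnn
  have hm1 : d.snd ∈ d.support := d.getVert_mem_support _
  have hm2 : d.penultimate ∈ d.support := d.getVert_mem_support _
  constructor
  · rw [← Finset.card_pair hsnd]
    refine card_le_card ?_
    intro x hx
    rw [mem_insert, mem_singleton] at hx
    rcases hx with rfl | rfl
    · simp [← hsup, hm1, ha1]
    · simp [← hsup, hm2, ha2.symm]
  · refine ⟨d.snd, by simp [← hsup, hm1], ha1.ne', fun A hA hw x hx => ?_⟩
    rw [mem_erase, List.mem_toFinset, ← hsup] at hx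
    cases d with
    | nil => exact absurd SimpleGraph.Walk.Nil.nil hnn
    | cons h p =>
      rw [SimpleGraph.Walk.snd_cons] at hw
      have hp := ((SimpleGraph.Walk.cons_isCycle_iff p h).1 hd).1
      have hxp : x ∈ p.support := by
        have := hx.2
        rw [SimpleGraph.Walk.support_cons, List.mem_cons] at this
        exact this.resolve_left hx.1
      refine walk_closed hA (p.takeUntil x hxp) (fun y hy => ?_) hw
      refine mem_erase.2 ⟨?_, hS ?_⟩
      · rintro rfl
        exact SimpleGraph.Walk.endpoint_notMem_support_takeUntil hp hxp hx.1.symm hy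
      · rw [List.mem_toFinset, ← hsup]
        have := p.support_takeUntil_subset_support hxp hy
        simp [this]

open scoped Classical in
lemma cycle_card {V : Type*} {G : SimpleGraph V} {u : V} (c : G.Walk u u) (hc : c.IsCycle) :
    c.support.toFinset.card = c.length := by
  have h1 : c.support.toFinset = c.support.tail.toFinset := by
    ext x
    simp only [List.mem_toFinset]
    constructor
    · intro hx
      rw [← SimpleGraph.Walk.cons_tail_support, List.mem_cons] at hx
      rcases hx with rfl | hx
      · exact SimpleGraph.Walk.end_mem_tail_support hc.not_nil
      · exact hx
    · exact List.mem_of_mem_tail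
  rw [h1, List.toFinset_card_of_nodup hc.support_nodup, List.length_tail,
    SimpleGraph.Walk.length_support]
  rfl

open scoped Classical in
lemma comp_cn {V : Type*} [Fintype V] {G : SimpleGraph V} (κ : G.ConnectedComponent) :
    Cn G (univ.filter (fun x => G.connectedComponentMk x = κ)) := by
  constructor
  · obtain ⟨x, hx⟩ := κ.exists_rep
    exact ⟨x, mem_filter.2 ⟨mem_univ _, hx⟩⟩
  · intro A hA ⟨a, ha⟩
    refine subset_antisymm hA.1 fun y hy => ?_
    have ha' := (mem_filter.1 (hA.1 ha)).2
    have hy' := (mem_filter.1 hy).2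
    obtain ⟨p⟩ := SimpleGraph.ConnectedComponent.exact (ha'.trans hy'.symm)
    refine walk_closed hA p (fun x hx => ?_) ha
    rw [mem_filter]
    refine ⟨mem_univ _, ?_⟩
    rw [← ha']
    exact (SimpleGraph.ConnectedComponent.sound ⟨p.takeUntil x hx⟩).symm

open scoped Classical in
/-- A good graph is tight on each component. -/
lemma tight_comp {V : Type*} [Fintype V] (G : SimpleGraph V)
    (hgood : (G.genIndepNum 4 : ℚ) = 3 / 4 * ((Nat.card V : ℚ) - (G.cycleDim : ℚ)))
    (κ₀ : G.ConnectedComponent) (S : Finset V)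
    (hS : S = univ.filter (fun x => G.connectedComponentMk x = κ₀)) :
    ∀ X ⊆ S, GI G (S \ X) → 3 * ee G S S + 6 ≤ 8 * X.card + 4 * S.card := by
  intro X0 hX0 hg0
  by_contra! hlt
  let F : G.ConnectedComponent → Finset V :=
    fun κ => univ.filter (fun x => G.connectedComponentMk x = κ)
  have hex : ∀ κ, ∃ X, X ⊆ F κ ∧ GI G (F κ \ X) ∧
      8 * X.card + 4 * (F κ).card + (if κ = κ₀ then 1 else 0) ≤ 3 * ee G (F κ) (F κ) + 6 := by
    intro κ
    by_cases h : κ = κ₀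
    · subst h
      subst hS
      refine ⟨X0, hX0, hg0, ?_⟩
      rw [if_pos rfl]
      exact hlt
    · obtain ⟨r, hr⟩ := (comp_cn κ).1
      obtain ⟨X, A, hX, -, -, -, -, hg, hb⟩ := main_bound _ (F κ) rfl (comp_cn κ) r hr
      refine ⟨X, hX, hg, ?_⟩
      rw [if_neg h]
      omega
  choose X hXF hXg hXb using hex
  have hFd : ∀ κ μ₂, κ ≠ μ₂ → Disjoint (F κ) (F μ₂) := by
    intro κ μ₂ h
    rw [disjoint_left]
    intro x hx hx'
    exact h ((mem_filter.1 hx).2.symm.trans (mem_filter.1 hx').2)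
  let Y : Finset V := univ.biUnion X
  have hYc : Y.card = ∑ κ, (X κ).card := card_biUnion fun κ _ μ₂ _ h =>
    disjoint_of_subset_left (hXF κ) (disjoint_of_subset_right (hXF μ₂) (hFd κ μ₂ h))
  have hFcl : ∀ κ, Cl G univ (F κ) := by
    intro κ
    refine ⟨subset_univ _, fun x hx y _ hxy => mem_filter.2 ⟨mem_univ _, ?_⟩⟩
    rw [← (mem_filter.1 hx).2]
    exact (SimpleGraph.ConnectedComponent.sound hxy.reachable).symm
  have hgi : G.IsGenIndepSet 4 (univ \ Y) := by
    intro T hT hTc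
    have hTc := cn_of_connected hTc
    obtain ⟨x, hx⟩ := hTc.1
    have hTF := (hFcl (G.connectedComponentMk x)).cn_subset (subset_univ T) hTc hx
      (by simp [F])
    refine hXg (G.connectedComponentMk x) T (fun y hy => mem_sdiff.2 ⟨hTF hy, fun h => ?_⟩) hTc
    exact (mem_sdiff.1 (hT hy)).2 (mem_biUnion.2 ⟨_, mem_univ _, h⟩)
  have hle : (univ \ Y).card ≤ G.genIndepNum 4 := by
    refine le_csSup ⟨Fintype.card V, ?_⟩ ⟨_, hgi, rfl⟩
    rintro _ ⟨S, -, rfl⟩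
    exact card_le_univ S
  have hYle : (univ \ Y).card + Y.card = Fintype.card V := by
    rw [card_sdiff_add_card_eq_card (subset_univ _)]; rfl
  have hFcard : ∑ κ, (F κ).card = Fintype.card V := by
    exact (card_eq_sum_card_fiberwise (s := univ) (t := univ)
      (f := G.connectedComponentMk) (by simp)).symm
  have hFee : ∑ κ, ee G (F κ) (F κ) = 2 * G.edgeFinset.card := by
    rw [← G.sum_degrees_eq_twice_card_edges]
    have h1 : ∀ κ, ee G (F κ) (F κ) = ∑ x ∈ F κ, G.degree x := by
      intro κ
      unfold ee
      refine sum_congr rfl fun x hx => ?_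
      rw [← G.card_neighborFinset_eq_degree, sum_boole]
      rw [Nat.cast_id]
      congr 1
      ext y
      simp only [mem_filter, SimpleGraph.mem_neighborFinset, and_iff_right_iff_imp]
      exact fun hxy => (hFcl κ).2 x hx y (mem_univ _) hxy
    simp only [h1]
    exact sum_fiberwise univ G.connectedComponentMk (fun x => G.degree x)
  have hsum := sum_le_sum (s := univ) fun κ _ => hXb κ
  simp only [sum_add_distrib, ← mul_sum, sum_ite_eq', mem_univ, if_true, sum_const, smul_eq_mul,
    hFcard, hFee, ← hYc, card_univ] at hsum
  unfold SimpleGraph.cycleDim at hgood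
  have hm : Nat.card G.edgeSet = G.edgeFinset.card := by
    rw [Nat.card_eq_fintype_card, SimpleGraph.edgeFinset_card]
  rw [hm, Nat.card_eq_fintype_card, Nat.card_eq_fintype_card] at hgood
  push_cast at hgood
  have hgood' : 4 * G.genIndepNum 4 + 3 * G.edgeFinset.card +
      3 * Fintype.card G.ConnectedComponent = 6 * Fintype.card V := by
    have : (4 * G.genIndepNum 4 + 3 * G.edgeFinset.card +
      3 * Fintype.card G.ConnectedComponent : ℚ) = 6 * Fintype.card V := by linarith
    exact_mod_cast this
  omega

end GoodCycle

/-- If `G` attains `α₄(G) = (3/4)(n - ω(G))`, then every cycle of `G` has length congruent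
to 1 modulo 4. -/
theorem good_cycle_length_mod_four {V : Type*} [Fintype V] (G : SimpleGraph V)
    (hgood : (G.genIndepNum 4 : ℚ) = 3 / 4 * ((Nat.card V : ℚ) - (G.cycleDim : ℚ))) :
    ∀ (u : V) (c : G.Walk u u), c.IsCycle → c.length % 4 = 1 := by
  classical
  intro u c hc
  have hsub : c.support.toFinset ⊆
      Finset.univ.filter (fun x => G.connectedComponentMk x = G.connectedComponentMk u) := by
    intro x hx
    rw [List.mem_toFinset] at hx
    refine Finset.mem_filter.2 ⟨Finset.mem_univ _, ?_⟩
    exact (SimpleGraph.ConnectedComponent.sound ⟨c.takeUntil x hx⟩).symm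
  rw [← GoodCycle.cycle_card c hc]
  refine GoodCycle.tight_mod (G := G) (GoodCycle.comp_cn (G.connectedComponentMk u)) ?_ hsub
    ⟨u, by simp⟩ ?_ ?_
  · exact GoodCycle.tight_comp G hgood (G.connectedComponentMk u) _ (by congr)
  · exact fun v hv => by convert (GoodCycle.cycle_facts c hc _ hsub v hv).1
  · exact fun v hv => by convert (GoodCycle.cycle_facts c hc _ hsub v hv).2
end

section
/- Let G be a graph with a pendant cycle C of length q (an induced cycle with exactly one vertex of degree 3 in G and all other cycle vertices of degree 2 in G), and suppose α_4(G) = (3/4)(|V(G)| − ω(G)). Then q ≡ 1 (mod 4) and α_4(G) = α_4(G − C) + (3/4)(q − 1), and G − C satisfies the same equality α_4(G − C) = (3/4)(|V(G − C)| − ω(G − C)). -/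
namespace PendantAux

open SimpleGraph Finset

/-- Edge count of a forest. -/
lemma forest_card {V : Type*} [Finite V] (F : SimpleGraph V) (hF : F.IsAcyclic) :
    Nat.card F.edgeSet + Nat.card F.ConnectedComponent = Nat.card V := by
  classical
  have := Fintype.ofFinite V
  have := Fintype.ofFinite F.ConnectedComponent
  let φ : (Σ c : F.ConnectedComponent, c.toSimpleGraph.edgeSet) → F.edgeSet :=
    fun x => ⟨x.2.1.map Subtype.val, by
      obtain ⟨c, e, he⟩ := x
      induction e using Sym2.ind with
      | _ a b => exact he⟩
  have hφ : Function.Bijective φ := by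
    constructor
    · rintro ⟨c, e, he⟩ ⟨d, f, hf⟩ h
      have h1 : e.map Subtype.val = f.map Subtype.val := congrArg Subtype.val h
      have hcd : c = d := by
        induction e using Sym2.ind with
        | _ a b =>
          induction f using Sym2.ind with
          | _ a' b' =>
            have : (a : V) ∈ Sym2.map Subtype.val s(a', b') := by
              rw [← h1]; simp
            have ha : F.connectedComponentMk a = c := a.2
            have hd : F.connectedComponentMk a = d := by
              simp only [Sym2.map_mk, Sym2.mem_iff] at this
              rcases this with h | h
              · rw [h]; exact a'.2
              · rw [h]; exact b'.2
            rw [← ha, hd]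
      subst hcd
      have : e = f := Sym2.map.injective Subtype.val_injective h1
      subst this
      rfl
    · rintro ⟨e, he⟩
      induction e using Sym2.ind with
      | _ a b =>
        have hab : F.Adj a b := he
        refine ⟨⟨F.connectedComponentMk a, s(⟨a, rfl⟩, ⟨b, ?_⟩), ?_⟩, rfl⟩
        · exact (ConnectedComponent.sound hab.reachable).symm
        · exact hab
  let ψ : (Σ c : F.ConnectedComponent, c) → V := fun x => x.2.1
  have hψ : Function.Bijective ψ := by
    constructor
    · rintro ⟨c, a, ha⟩ ⟨d, b, hb⟩ h
      have h1 : a = b := h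
      subst h1
      have h2 : F.connectedComponentMk a = c := ha
      have h3 : F.connectedComponentMk a = d := hb
      subst h2
      subst h3
      rfl
    · intro v
      exact ⟨⟨F.connectedComponentMk v, v, rfl⟩, rfl⟩
  rw [← Nat.card_eq_of_bijective φ hφ, ← Nat.card_eq_of_bijective ψ hψ, Nat.card_sigma,
    Nat.card_sigma, Nat.card_eq_fintype_card (α := F.ConnectedComponent)]
  have : ∀ c : F.ConnectedComponent, Nat.card c = Nat.card c.toSimpleGraph.edgeSet + 1 := by
    intro c
    have := (hF.isTree_connectedComponent c).card_edgeFinset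
    rw [Nat.card_eq_fintype_card, Nat.card_eq_fintype_card, ← this, edgeFinset_card]
  rw [Finset.sum_congr rfl (fun c _ => this c), Finset.sum_add_distrib]
  simp

lemma exists_forest {V : Type*} [Finite V] (G : SimpleGraph V) :
    ∃ F ≤ G, F.IsAcyclic ∧ (Nat.card G.edgeSet : ℤ) = Nat.card F.edgeSet + G.cycleDim := by
  obtain ⟨F, hle, hF, hr⟩ := G.exists_isAcyclic_reachable_eq_le
  refine ⟨F, hle, hF, ?_⟩
  have h1 := forest_card F hF
  have h2 : Nat.card F.ConnectedComponent = Nat.card G.ConnectedComponent := by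
    unfold ConnectedComponent
    rw [hr]
  unfold SimpleGraph.cycleDim
  omega

lemma cycleDim_le {V : Type*} [Finite V] (G F : SimpleGraph V) (hle : F ≤ G)
    (hF : F.IsAcyclic) : Nat.card F.edgeSet + G.cycleDim ≤ (Nat.card G.edgeSet : ℤ) := by
  have h1 := forest_card F hF
  have h2 : Nat.card G.ConnectedComponent ≤ Nat.card F.ConnectedComponent :=
    Nat.card_le_card_of_surjective _ <| ConnectedComponent.surjective_map_ofLE hle
  unfold SimpleGraph.cycleDim
  omega

lemma le_genIndepNum {V : Type*} [Fintype V] (G : SimpleGraph V) (k : ℕ) (S : Finset V)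
    (h : G.IsGenIndepSet k S) : S.card ≤ G.genIndepNum k := by
  apply le_csSup
  · exact ⟨Fintype.card V, by rintro n ⟨S, -, rfl⟩; exact S.card_le_univ⟩
  · exact ⟨S, h, rfl⟩

lemma exists_genIndepNum {V : Type*} [Fintype V] (G : SimpleGraph V) (k : ℕ) (hk : 0 < k) :
    ∃ S : Finset V, G.IsGenIndepSet k S ∧ S.card = G.genIndepNum k := by
  have : G.genIndepNum k ∈ {n | ∃ S : Finset V, G.IsGenIndepSet k S ∧ S.card = n} := by
    apply Nat.sSup_mem
    · refine ⟨0, ∅, ?_, rfl⟩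
      intro T hT _
      rw [Finset.subset_empty.1 hT]
      exact hk
    · exact ⟨Fintype.card V, by rintro n ⟨S, -, rfl⟩; exact S.card_le_univ⟩
  exact this

/-- A property stable along edges inside a connected set propagates. -/
lemma conn_prop {V : Type*} {G : SimpleGraph V} {T : Set V}
    (hT : (G.induce T).Connected) (P : V → Prop)
    (hP : ∀ a ∈ T, ∀ b ∈ T, G.Adj a b → P a → P b) {a b : V} (ha : a ∈ T) (hb : b ∈ T)
    (h : P a) : P b := by
  obtain ⟨p⟩ := hT.preconnected ⟨a, ha⟩ ⟨b, hb⟩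
  have key : ∀ (x y : T) (p : (G.induce T).Walk x y), P x → P y := by
    intro x y p
    induction p with
    | nil => exact id
    | cons hadj p ih =>
      intro hx
      exact ih (hP _ (Subtype.prop _) _ (Subtype.prop _) hadj hx)
  exact key _ _ p h

lemma acyclic_unique {V : Type*} {G : SimpleGraph V} (hG : G.IsAcyclic) {T : Set V}
    (hT : (G.induce T).Connected) {v a b : V} (hv : v ∉ T) (ha : a ∈ T) (hb : b ∈ T)
    (hva : G.Adj v a) (hvb : G.Adj v b) : a = b := by
  by_contra hne
  obtain ⟨p, hp⟩ := (hT.preconnected ⟨a, ha⟩ ⟨b, hb⟩).exists_isPath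
  let p1 : G.Path a b := ⟨p.map (Embedding.induce T).toHom,
    hp.map (Embedding.induce (G := G) T).injective⟩
  let p2 : G.Path a b := ⟨Walk.cons hva.symm (Walk.cons hvb Walk.nil), by
    simp [hva.ne', hvb.ne, hne]⟩
  have h := (hG.subsingleton_path a b).elim p1 p2
  have h2 : v ∈ p1.1.support := by
    rw [h]; simp [p2]
  have h2 : v ∈ (p.map (Embedding.induce T).toHom).support := h2
  rw [Walk.support_map, List.mem_map] at h2
  obtain ⟨x, -, hx⟩ := h2
  exact hv (hx ▸ x.2)

lemma forest_step {V : Type*} [DecidableEq V] (G : SimpleGraph V) (hG : G.IsAcyclic)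
    (A : Finset V) (hA : 4 ≤ A.card) :
    ∃ B ⊆ A, ∃ v ∈ B, 4 ≤ B.card ∧ (∀ x ∈ B, x ≠ v → ∀ y ∈ A, y ∉ B → ¬ G.Adj x y) ∧
      G.IsGenIndepSet 4 (B.erase v) := by
  have key : ∀ n : ℕ, ∀ B ⊆ A, ∀ v ∈ B, B.card = n → 4 ≤ B.card →
      (∀ x ∈ B, x ≠ v → ∀ y ∈ A, y ∉ B → ¬ G.Adj x y) →
      ∃ B ⊆ A, ∃ v ∈ B, 4 ≤ B.card ∧ (∀ x ∈ B, x ≠ v → ∀ y ∈ A, y ∉ B → ¬ G.Adj x y) ∧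
      G.IsGenIndepSet 4 (B.erase v) := by
    intro n
    induction n using Nat.strong_induction_on with
    | _ n ih =>
    intro B hBA v hv hn h4 hsep
    by_cases hgi : G.IsGenIndepSet 4 (B.erase v)
    · exact ⟨B, hBA, v, hv, h4, hsep, hgi⟩
    unfold SimpleGraph.IsGenIndepSet at hgi
    push Not at hgi
    obtain ⟨T0, hT0, hc0, hcard0⟩ := hgi
    classical
    obtain ⟨T, hTmem, hmax⟩ := Finset.exists_max_image
      ((B.erase v).powerset.filter fun T : Finset V => (G.induce (T : Set V)).Connected ∧ 4 ≤ T.card)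
      Finset.card ⟨T0, by simp [hT0, hc0, hcard0]⟩
    simp only [Finset.mem_filter, Finset.mem_powerset] at hTmem hmax
    obtain ⟨hTB, hTc, hT4⟩ := hTmem
    have hvT : v ∉ T := fun h => by simpa using hTB h
    have hmx : ∀ x ∈ T, ∀ y ∈ B.erase v, y ∉ T → ¬ G.Adj x y := by
      intro x hx y hy hyT hadj
      have hc : (G.induce ((insert y T : Finset V) : Set V)).Connected := by
        have := connected_induce_union (G := G) (s := (T : Set V)) (t := {y})
          hTc.preconnected (by
            intro a b
            have : a = b := Subsingleton.elim _ _
            rw [this]) hx rfl hadj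
        have e : ((insert y T : Finset V) : Set V) = (T : Set V) ∪ {y} := by
          ext z; simp [or_comm]
        rw [e]; exact this
      have h1 := hmax (insert y T) ⟨Finset.insert_subset hy hTB, hc, by
        rw [Finset.card_insert_of_notMem hyT]; omega⟩
      rw [Finset.card_insert_of_notMem hyT] at h1
      omega
    have hlt : T.card < n := by
      have := Finset.card_le_card hTB
      rw [Finset.card_erase_of_mem hv] at this
      omega
    have hTB' : T ⊆ B := hTB.trans (Finset.erase_subset _ _)
    obtain ⟨t, htT, ht⟩ : ∃ t ∈ T, ∀ x ∈ T, x ≠ t → ¬ G.Adj x v := by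
      by_cases h : ∃ t ∈ T, G.Adj t v
      · obtain ⟨t, ht, hadj⟩ := h
        refine ⟨t, ht, fun x hx hne hxv => hne ?_⟩
        exact acyclic_unique hG hTc (by simpa using hvT) hx ht hxv.symm hadj.symm
      · push Not at h
        obtain ⟨t, ht⟩ : T.Nonempty := by rw [← Finset.card_pos]; omega
        exact ⟨t, ht, fun x hx _ => h x hx⟩
    refine ih T.card hlt T (hTB'.trans hBA) t htT rfl hT4 ?_
    intro x hx hxt y hyA hyT
    by_cases hyv : y = v
    · subst hyv; exact ht x hx hxt
    by_cases hyB : y ∈ B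
    · exact hmx x hx y (by simp [hyv, hyB]) hyT
    · exact hsep x (hTB' hx) (fun h => hvT (h ▸ hx)) y hyA hyB
  obtain ⟨v, hv⟩ : A.Nonempty := by rw [← Finset.card_pos]; omega
  exact key _ A (Finset.Subset.refl _) v hv rfl hA (fun x _ _ y hy hy' => absurd hy hy')

/-- Union of two mutually non-adjacent generalized independent sets. -/
lemma genIndep_union {V : Type*} [DecidableEq V] (G : SimpleGraph V) (k : ℕ) (S T : Finset V)
    (hS : G.IsGenIndepSet k S) (hT : G.IsGenIndepSet k T)
    (h : ∀ x ∈ S, ∀ y ∈ T, ¬ G.Adj x y) : G.IsGenIndepSet k (S ∪ T) := by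
  intro U hU hc
  obtain ⟨⟨a, ha⟩⟩ := hc.nonempty
  have ha' : a ∈ U := ha
  rcases Finset.mem_union.1 (hU ha') with haS | haT
  · refine hS U (fun b hb => ?_) hc
    refine conn_prop hc (fun x => x ∈ S) ?_ ha hb haS
    intro x hx y hy hadj hxS
    rcases Finset.mem_union.1 (hU hy) with h1 | h1
    · exact h1
    · exact absurd hadj (h x hxS y h1)
  · refine hT U (fun b hb => ?_) hc
    refine conn_prop hc (fun x => x ∈ T) ?_ ha hb haT
    intro x hx y hy hadj hxS
    rcases Finset.mem_union.1 (hU hy) with h1 | h1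
    · exact absurd hadj.symm (h y h1 x hxS)
    · exact h1

lemma forest_bound {V : Type*} [DecidableEq V] (G : SimpleGraph V) (hG : G.IsAcyclic)
    (n : ℕ) : ∀ A : Finset V, A.card = n →
      ∃ S ⊆ A, G.IsGenIndepSet 4 S ∧ 3 * A.card ≤ 4 * S.card := by
  induction n using Nat.strong_induction_on with
  | _ n ih =>
  intro A hn
  by_cases h4 : 4 ≤ A.card
  · obtain ⟨B, hBA, v, hv, hB4, hsep, hgi⟩ := forest_step G hG A h4
    have hc := Finset.card_sdiff_add_card_eq_card hBA
    obtain ⟨S, hSA, hS, hcard⟩ := ih (A \ B).card (by omega) (A \ B) rfl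
    have hd : Disjoint (B.erase v) S := by
      rw [Finset.disjoint_left]
      intro x hx hxS
      have := hSA hxS
      simp at this hx
      exact this.2 hx.2
    refine ⟨B.erase v ∪ S, ?_, genIndep_union G 4 _ _ hgi hS ?_, ?_⟩
    · exact Finset.union_subset ((Finset.erase_subset _ _).trans hBA)
        (hSA.trans Finset.sdiff_subset)
    · intro x hx y hy
      have := hSA hy
      simp at this hx
      exact hsep x hx.2 hx.1 y this.1 this.2
    · rw [Finset.card_union_of_disjoint hd, Finset.card_erase_of_mem hv]
      omega
  · refine ⟨A, Finset.Subset.refl _, ?_, by omega⟩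
    intro T hT _
    have := Finset.card_le_card hT
    omega

lemma general_bound {V : Type*} [Fintype V] (G : SimpleGraph V) :
    3 * ((Nat.card V : ℤ) - G.cycleDim) ≤ 4 * G.genIndepNum 4 := by
  classical
  obtain ⟨F, hle, hF, hm⟩ := exists_forest G
  let X : Finset V := (G.edgeFinset \ F.edgeFinset).image fun e => e.out.1
  have hX : (X.card : ℤ) ≤ G.cycleDim := by
    have h1 : X.card ≤ (G.edgeFinset \ F.edgeFinset).card := Finset.card_image_le
    have h2 := Finset.card_sdiff_add_card_eq_card (edgeFinset_mono hle)
    rw [Nat.card_eq_fintype_card, Nat.card_eq_fintype_card, ← edgeFinset_card,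
      ← edgeFinset_card] at hm
    omega
  obtain ⟨S, hSA, hS, hcard⟩ := forest_bound F hF _ Xᶜ rfl
  have hGS : G.IsGenIndepSet 4 S := by
    intro T hT hc
    refine hS T hT ?_
    have : G.induce (T : Set V) = F.induce (T : Set V) := by
      ext a b
      simp only [comap_adj, Function.Embedding.subtype_apply]
      refine ⟨fun h => ?_, fun h => hle h⟩
      by_contra hn
      have hx : (s((a : V), (b : V))).out.1 ∈ X := by
        apply Finset.mem_image_of_mem
        simp [h, hn]
      have hm := Sym2.out_fst_mem s((a : V), (b : V))
      have ha := hSA (hT a.2)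
      have hb := hSA (hT b.2)
      rw [Finset.mem_compl] at ha hb
      rcases Sym2.mem_iff.1 hm with h1 | h1
      · rw [h1] at hx; exact ha hx
      · rw [h1] at hx; exact hb hx
    rw [← this]; exact hc
  have h1 := le_genIndepNum G 4 S hGS
  have h2 := Finset.card_compl_add_card X
  rw [Nat.card_eq_fintype_card]
  omega

lemma cycleDim_induce {V : Type*} [Fintype V] (G : SimpleGraph V) {u : V} (c : G.Walk u u)
    (hc : c.IsCycle) : (G.induce {x | x ∉ c.support}).cycleDim + 1 ≤ G.cycleDim := by
  classical
  obtain ⟨F, hle, hF, hm⟩ := exists_forest G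
  obtain ⟨e, hec, heF⟩ : ∃ e ∈ c.edges, e ∉ F.edgeSet := by
    by_contra h
    push Not at h
    exact hF (c.transfer F h) (hc.transfer h)
  have hle' : F.induce {x | x ∉ c.support} ≤ G.induce {x | x ∉ c.support} := by
    intro a b h
    exact hle h
  have h1 := cycleDim_le (G.induce {x | x ∉ c.support}) (F.induce {x | x ∉ c.support})
    hle' (hF.induce _)
  rw [Nat.card_eq_fintype_card, Nat.card_eq_fintype_card, ← edgeFinset_card,
      ← edgeFinset_card] at hm h1
  have h2 := Finset.card_sdiff_add_card_eq_card (edgeFinset_mono hle)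
  have h3 := Finset.card_sdiff_add_card_eq_card (edgeFinset_mono hle')
  have h4 : ((G.induce {x | x ∉ c.support}).edgeFinset \
      (F.induce {x | x ∉ c.support}).edgeFinset).card ≤
      ((G.edgeFinset \ F.edgeFinset).erase e).card := by
    refine Finset.card_le_card_of_injOn (Sym2.map Subtype.val) ?_
      (Sym2.map.injective Subtype.val_injective).injOn
    intro f hf
    induction f using Sym2.ind with
    | _ a b =>
      simp only [coe_sdiff, coe_edgeFinset, Set.mem_sdiff, mem_edgeSet, comap_adj,
        Function.Embedding.subtype_apply] at hf
      simp only [Sym2.map_mk, coe_erase, coe_sdiff, coe_edgeFinset, Set.mem_sdiff, mem_edgeSet,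
        Set.mem_singleton_iff]
      refine ⟨hf, ?_⟩
      rintro rfl
      exact a.2 (c.fst_mem_support_of_mem_edges hec)
  rw [Finset.card_erase_of_mem (by simp [heF, c.edges_subset_edgeSet hec])] at h4
  have h5 : 0 < (G.edgeFinset \ F.edgeFinset).card :=
    Finset.card_pos.2 ⟨e, by simp [heF, c.edges_subset_edgeSet hec]⟩
  omega

lemma card_block (q : ℕ) : ((Finset.range q).filter fun i => i % 4 ≠ 0).card + (q + 3) / 4 = q := by
  induction q with
  | zero => simp
  | succ n ih =>
    rw [Finset.range_add_one, Finset.filter_insert]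
    split_ifs with h
    · rw [Finset.card_insert_of_notMem (by simp)]
      omega
    · omega

lemma genIndep_of_induce {V : Type*} (G : SimpleGraph V) (s : Set V) (k : ℕ) (S : Finset s)
    (hS : (G.induce s).IsGenIndepSet k S) :
    G.IsGenIndepSet k (S.map (Function.Embedding.subtype _)) := by
  classical
  intro T hT hc
  have hTs : ∀ x ∈ T, x ∈ s := by
    intro x hx
    obtain ⟨y, -, rfl⟩ := Finset.mem_map.1 (hT hx)
    exact y.2
  have hcard : (T.subtype (· ∈ s)).card = T.card := by
    rw [Finset.card_subtype, Finset.filter_true_of_mem hTs]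
  rw [← hcard]
  apply hS
  · intro x hx
    obtain ⟨y, hy, hyx⟩ := Finset.mem_map.1 (hT (Finset.mem_subtype.1 hx))
    have : y = x := Subtype.ext hyx
    exact this ▸ hy
  · let f : G.induce (T : Set V) →g (G.induce s).induce ((T.subtype (· ∈ s) : Finset s) : Set s) :=
      { toFun := fun x => ⟨⟨x.1, hTs x.1 x.2⟩, by simpa using x.2⟩
        map_rel' := fun h => h }
    refine hc.map f ?_
    rintro ⟨⟨x, hx⟩, hxT⟩
    exact ⟨⟨x, by simpa using hxT⟩, rfl⟩

lemma path_block {V : Type*} [DecidableEq V] (G : SimpleGraph V) {w : V} (c : G.Walk w w)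
    (hc : c.IsCycle)
    (hsep : ∀ v ∈ c.support, v ≠ w → ∀ y, G.Adj v y → s(v, y) ∈ c.edges) :
    ∃ S : Finset V, G.IsGenIndepSet 4 S ∧ (∀ x ∈ S, x ∈ c.support ∧ x ≠ w) ∧
      3 * (c.length - 1) ≤ 4 * S.card := by
  set I := (Finset.range c.length).filter fun i => i % 4 ≠ 0 with hI
  have hinj := hc.getVert_injOn
  have hne : ∀ i ∈ I, c.getVert i ≠ w := by
    intro i hi h
    simp only [hI, Finset.mem_filter, Finset.mem_range] at hi
    have h1 : c.getVert i = c.getVert c.length := by rw [h, c.getVert_length]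
    have := hinj (show i ∈ {i | 1 ≤ i ∧ i ≤ c.length} by simp; omega)
      (show c.length ∈ {i | 1 ≤ i ∧ i ≤ c.length} by simp; omega) h1
    omega
  refine ⟨I.image c.getVert, ?_, ?_, ?_⟩
  · intro T hT hconn
    obtain ⟨⟨a, ha⟩⟩ := hconn.nonempty
    obtain ⟨i0, hi0, hi0a⟩ := Finset.mem_image.1 (hT ha)
    have hall : ∀ b ∈ T, ∃ i ∈ I, i / 4 = i0 / 4 ∧ c.getVert i = b := by
      intro b hb
      refine conn_prop hconn (fun x => ∃ i ∈ I, i / 4 = i0 / 4 ∧ c.getVert i = x) ?_ ha hb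
        ⟨i0, hi0, rfl, hi0a⟩
      rintro x hx y hy hadj ⟨i, hi, hdiv, rfl⟩
      obtain ⟨j, hj, rfl⟩ := Finset.mem_image.1 (hT hy)
      refine ⟨j, hj, ?_, rfl⟩
      have he := hsep _ (c.getVert_mem_support i) (hne i hi) _ hadj
      have hnei := hne i hi
      have hnej := hne j hj
      rw [← Walk.adj_toSubgraph_iff_mem_edges, Walk.toSubgraph_adj_iff] at he
      obtain ⟨k, hk, hkl⟩ := he
      simp only [hI, Finset.mem_filter, Finset.mem_range] at hi hj
      have hk0 : k ≠ 0 := by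
        rintro rfl
        rw [c.getVert_zero] at hk
        rcases Sym2.eq_iff.1 hk with h | h
        · exact hnei h.1.symm
        · exact hnej h.1.symm
      have hinj' : ∀ a b, 1 ≤ a → a ≤ c.length → 1 ≤ b → b ≤ c.length →
          c.getVert a = c.getVert b → a = b := fun a b h1 h2 h3 h4 h =>
        hinj (show a ∈ {i | 1 ≤ i ∧ i ≤ c.length} from ⟨h1, h2⟩) ⟨h3, h4⟩ h
      rcases Sym2.eq_iff.1 hk with ⟨h1, h2⟩ | ⟨h1, h2⟩
      · have := hinj' _ _ (by omega) (by omega) (by omega) (by omega) h1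
        have := hinj' _ _ (by omega) (by omega) (by omega) (by omega) h2
        omega
      · have := hinj' _ _ (by omega) (by omega) (by omega) (by omega) h1
        have := hinj' _ _ (by omega) (by omega) (by omega) (by omega) h2
        omega
    have hsub : T ⊆ ({4 * (i0 / 4) + 1, 4 * (i0 / 4) + 2, 4 * (i0 / 4) + 3} : Finset ℕ).image
        c.getVert := by
      intro b hb
      obtain ⟨i, hi, hdiv, rfl⟩ := hall b hb
      apply Finset.mem_image_of_mem
      simp only [hI, Finset.mem_filter, Finset.mem_range] at hi
      simp only [Finset.mem_insert, Finset.mem_singleton]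
      omega
    have h1 := Finset.card_le_card hsub
    have h2 := Finset.card_image_le (s := ({4 * (i0 / 4) + 1, 4 * (i0 / 4) + 2,
      4 * (i0 / 4) + 3} : Finset ℕ)) (f := c.getVert)
    have h3 := Finset.card_le_three (a := 4 * (i0 / 4) + 1) (b := 4 * (i0 / 4) + 2)
      (c := 4 * (i0 / 4) + 3)
    omega
  · intro x hx
    obtain ⟨i, hi, rfl⟩ := Finset.mem_image.1 hx
    exact ⟨c.getVert_mem_support i, hne i hi⟩
  · rw [Finset.card_image_of_injOn]
    · have := card_block c.length
      rw [← hI] at this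
      omega
    · intro i hi j hj h
      simp only [hI, Finset.coe_filter, Finset.mem_range, Set.mem_ofPred_eq] at hi hj
      exact hinj (show i ∈ {i | 1 ≤ i ∧ i ≤ c.length} from ⟨by omega, by omega⟩)
        ⟨by omega, by omega⟩ h

lemma alpha_bound {V : Type*} [Fintype V] (G : SimpleGraph V) {u : V} (c : G.Walk u u)
    (hc : c.IsCycle) (w : V) (hw : w ∈ c.support)
    (hdeg2 : ∀ v ∈ c.support, v ≠ w → Nat.card (G.neighborSet v) = 2) :
    4 * (G.induce {x | x ∉ c.support}).genIndepNum 4 + 3 * (c.length - 1)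
      ≤ 4 * G.genIndepNum 4 := by
  classical
  have hsep : ∀ v ∈ c.support, v ≠ w → ∀ y, G.Adj v y → s(v, y) ∈ c.edges := by
    intro v hv hvw y hadj
    have h1 := hc.ncard_neighborSet_toSubgraph_eq_two hv
    have h2 : (G.neighborSet v).ncard = 2 := hdeg2 v hv hvw
    have h3 : c.toSubgraph.neighborSet v = G.neighborSet v :=
      Set.eq_of_subset_of_ncard_le (c.toSubgraph.neighborSet_subset v) (by omega)
    have h4 : y ∈ c.toSubgraph.neighborSet v := by rw [h3]; exact hadj
    exact Walk.adj_toSubgraph_iff_mem_edges.1 h4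
  obtain ⟨P, hP, hPc, hPcard⟩ := path_block G (c.rotate w hw) (hc.rotate hw) (by
    intro v hv hvw y hadj
    rw [Walk.mem_support_rotate_iff] at hv
    exact (c.rotate_edges w hw).mem_iff.2 (hsep v hv hvw y hadj))
  rw [Walk.length_rotate] at hPcard
  obtain ⟨S, hS, hScard⟩ := exists_genIndepNum (G.induce {x | x ∉ c.support}) 4 (by norm_num)
  have hS' := genIndep_of_induce G _ 4 S hS
  have hSx : ∀ x ∈ S.map (Function.Embedding.subtype _), x ∉ c.support := by
    intro x hx
    obtain ⟨y, -, rfl⟩ := Finset.mem_map.1 hx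
    exact y.2
  have hPc' : ∀ x ∈ P, x ∈ c.support ∧ x ≠ w := by
    intro x hx
    have := hPc x hx
    rwa [Walk.mem_support_rotate_iff] at this
  have hU := genIndep_union G 4 P _ hP hS' (by
    intro x hx y hy hadj
    have h1 := hsep x (hPc' x hx).1 (hPc' x hx).2 y hadj
    exact hSx y hy (c.snd_mem_support_of_mem_edges h1))
  have h1 := le_genIndepNum G 4 _ hU
  rw [Finset.card_union_of_disjoint, Finset.card_map] at h1
  · omega
  · rw [Finset.disjoint_left]
    intro x hx hxS
    exact hSx x hxS (hPc' x hx).1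

lemma card_compl_support {V : Type*} [Fintype V] (G : SimpleGraph V) {u : V} (c : G.Walk u u)
    (hc : c.IsCycle) : Nat.card {x | x ∉ c.support} + c.length = Nat.card V := by
  classical
  have h1 : {x | x ∉ c.support} = ((c.support.tail.toFinset : Finset V) : Set V)ᶜ := by
    ext x
    simp only [Set.mem_ofPred_eq, Set.mem_compl_iff, Finset.mem_coe, List.mem_toFinset]
    rw [not_iff_not]
    refine ⟨fun h => ?_, List.mem_of_mem_tail⟩
    rw [← c.cons_tail_support, List.mem_cons] at h
    rcases h with rfl | h
    · exact c.end_mem_tail_support hc.not_nil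
    · exact h
  have h2 : c.support.tail.toFinset.card = c.length := by
    rw [List.toFinset_card_of_nodup hc.support_nodup]
    simp
  rw [h1, Nat.card_coe_set_eq, ← Finset.coe_compl, Set.ncard_coe_finset, ← h2,
    Finset.card_compl_add_card, Nat.card_eq_fintype_card]

end PendantAux

/-- Let `G` attain `α₄(G) = (3/4)(n - ω(G))` and let `c` be a pendant cycle of length `q`:
an induced cycle having exactly one vertex `w` of degree 3 in `G`, all its other vertices
having degree 2 in `G`. Then `q ≡ 1 (mod 4)`, `α₄(G) = α₄(G - C) + (3/4)(q - 1)`, and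
`G - C` again attains the bound. -/
theorem good_pendant_cycle {V : Type*} [Fintype V] (G : SimpleGraph V)
    (u : V) (c : G.Walk u u) (hc : c.IsCycle)
    (hinduced : ∀ a b : V, a ∈ c.support → b ∈ c.support → G.Adj a b → s(a, b) ∈ c.edges)
    (w : V) (hw : w ∈ c.support) (hw3 : Nat.card (G.neighborSet w) = 3)
    (hdeg2 : ∀ v ∈ c.support, v ≠ w → Nat.card (G.neighborSet v) = 2)
    (hgood : (G.genIndepNum 4 : ℚ) = 3 / 4 * ((Nat.card V : ℚ) - (G.cycleDim : ℚ))) :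
    c.length % 4 = 1 ∧
      (G.genIndepNum 4 : ℚ) =
        ((G.induce {x | x ∉ c.support}).genIndepNum 4 : ℚ) + 3 / 4 * ((c.length : ℚ) - 1) ∧
      ((G.induce {x | x ∉ c.support}).genIndepNum 4 : ℚ) =
        3 / 4 * ((Nat.card {x | x ∉ c.support} : ℚ) -
          ((G.induce {x | x ∉ c.support}).cycleDim : ℚ)) := by

  classical
  have h1 := PendantAux.general_bound (G.induce {x | x ∉ c.support})
  have h2 := PendantAux.cycleDim_induce G c hc
  have h3 := PendantAux.alpha_bound G c hc w hw hdeg2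
  have h4 := PendantAux.card_compl_support G c hc
  have h5 := hc.three_le_length
  have hg : 4 * (G.genIndepNum 4 : ℤ) = 3 * ((Nat.card V : ℤ) - G.cycleDim) := by
    have : (4 * (G.genIndepNum 4 : ℚ)) = 3 * ((Nat.card V : ℚ) - (G.cycleDim : ℚ)) := by
      rw [hgood]; ring
    exact_mod_cast this
  have e1 : 4 * (G.genIndepNum 4 : ℤ) =
      4 * ((G.induce {x | x ∉ c.support}).genIndepNum 4 : ℤ) + 3 * ((c.length : ℤ) - 1) := by
    omega
  have e2 : 4 * ((G.induce {x | x ∉ c.support}).genIndepNum 4 : ℤ) =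
      3 * ((Nat.card {x | x ∉ c.support} : ℤ) -
          (G.induce {x | x ∉ c.support}).cycleDim) := by
    omega
  refine ⟨by omega, ?_, ?_⟩
  · have e1' : 4 * (G.genIndepNum 4 : ℚ) =
      4 * ((G.induce {x | x ∉ c.support}).genIndepNum 4 : ℚ) + 3 * ((c.length : ℚ) - 1) := by
      exact_mod_cast e1
    linarith
  · have e2' : 4 * ((G.induce {x | x ∉ c.support}).genIndepNum 4 : ℚ) =
      3 * ((Nat.card {x | x ∉ c.support} : ℚ) -
          ((G.induce {x | x ∉ c.support}).cycleDim : ℚ)) := by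
      exact_mod_cast e2
    linarith
end
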